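/- Let n ∈ ℕ, q ∈ (0,1], and let F be a real polynomial of degree ≤ n. Then F *_q^n G ∈ 𝓡_n(q) for every G ∈ 𝓡_n(q) if and only if F(z) ∈ 𝓝̄_n(q) or F(−z) ∈ 𝓝̄_n(q). -/

import Mathlib

open Polynomial Filter

open scoped Classical

noncomputable section

/-- `R_n(q;z) = ∏_{j=1}^n (1 + q^{j-1} z)`, the generating polynomial of the
q-binomial coefficients. -/
def Rpoly (n : ℕ) (q : ℝ) : Polynomial ℝ :=
  ∏ j ∈ Finset.range n, (1 + Polynomial.C (q ^ j) * Polynomial.X)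

/-- The q-binomial coefficient `C_k^n(q)`. -/
def qBinom (n k : ℕ) (q : ℝ) : ℝ := (Rpoly n q).coeff k

/-- The weighted Hadamard product `F *_q^n G`: if `F = ∑ C_k^n(q) a_k z^k` and
`G = ∑ C_k^n(q) b_k z^k`, then `F *_q^n G = ∑ C_k^n(q) a_k b_k z^k`. -/
def qHadamard (n : ℕ) (q : ℝ) (F G : Polynomial ℝ) : Polynomial ℝ :=
  ∑ k ∈ Finset.range (n + 1),
    Polynomial.C (F.coeff k * G.coeff k / qBinom n k q) * Polynomial.X ^ k

/-- All zeros of the real polynomial `F` are real (it splits over `ℝ`). -/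
def RealRooted (F : Polynomial ℝ) : Prop :=
  F = 0 ∨ F.roots.card = F.natDegree

/-- All real roots of `F` are nonpositive. -/
def OnlyNonposRoots (F : Polynomial ℝ) : Prop := ∀ x ∈ F.roots, x ≤ 0

/-- The multiset `s` (of zeros, with multiplicity) is logarithmically q-separated. -/
def LogSep (q : ℝ) (s : Multiset ℝ) : Prop :=
  (∀ x ∈ s, x ≠ 0 → 2 ≤ s.count x → (1 : ℝ) ≤ q) ∧
  (∀ x ∈ s, ∀ y ∈ s, ((y < x ∧ x < 0) ∨ (0 < x ∧ x < y)) → x / y ≤ q)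

/-- The multiset `s` (of zeros, with multiplicity) is strictly logarithmically
q-separated. -/
def StrictLogSep (q : ℝ) (s : Multiset ℝ) : Prop :=
  (∀ x ∈ s, x ≠ 0 → 2 ≤ s.count x → (1 : ℝ) < q) ∧
  (∀ x ∈ s, ∀ y ∈ s, ((y < x ∧ x < 0) ∨ (0 < x ∧ x < y)) → x / y < q)

/-- The class `𝓡̄_n(q)`. -/
def memRbar (n : ℕ) (q : ℝ) (F : Polynomial ℝ) : Prop :=
  F.natDegree ≤ n ∧ RealRooted F ∧ LogSep q F.roots

/-- The class `𝓡_n(q)`. -/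
def memR (n : ℕ) (q : ℝ) (F : Polynomial ℝ) : Prop :=
  F.natDegree ≤ n ∧ RealRooted F ∧ StrictLogSep q F.roots

/-- The class `𝓝̄_n(q)`. -/
def memNbar (n : ℕ) (q : ℝ) (F : Polynomial ℝ) : Prop :=
  memRbar n q F ∧ OnlyNonposRoots F

/-- The class `𝓝_n(q)`. -/
def memN (n : ℕ) (q : ℝ) (F : Polynomial ℝ) : Prop :=
  memR n q F ∧ OnlyNonposRoots F

/-- `F ≼ G` : both have only real zeros and `F'G - FG' ≤ 0` on `ℝ`. -/
def Prec (F G : Polynomial ℝ) : Prop :=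
  RealRooted F ∧ RealRooted G ∧
    ∀ x : ℝ, (Polynomial.derivative F * G - F * Polynomial.derivative G).eval x ≤ 0

/-- `F ≺ G` : `F ≼ G` and no common zeros. -/
def PrecS (F G : Polynomial ℝ) : Prop :=
  Prec F G ∧ ∀ x : ℝ, ¬ (F.eval x = 0 ∧ G.eval x = 0)

/-- `F ≺₀ G` : `F ≼ G` and no common zeros except possibly at the origin. -/
def Prec0 (F G : Polynomial ℝ) : Prop :=
  Prec F G ∧ ∀ x : ℝ, x ≠ 0 → ¬ (F.eval x = 0 ∧ G.eval x = 0)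

/-- `F ⋎ G` : `G ≼ zF`. -/
def Veebar (F G : Polynomial ℝ) : Prop := Prec G (Polynomial.X * F)

/-- `F ∨ G` : `F ⋎ G` and no common zeros except possibly at the origin. -/
def VeeS (F G : Polynomial ℝ) : Prop :=
  Veebar F G ∧ ∀ x : ℝ, x ≠ 0 → ¬ (F.eval x = 0 ∧ G.eval x = 0)

/-- `F ⊴ G` : `F ⋎ G` for polynomials with only nonpositive zeros. -/
def TriLE (F G : Polynomial ℝ) : Prop :=
  OnlyNonposRoots F ∧ OnlyNonposRoots G ∧ Veebar F G

/-- `F ◁ G` : `F ∨ G` for polynomials with only nonpositive zeros. -/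
def TriLT (F G : Polynomial ℝ) : Prop :=
  OnlyNonposRoots F ∧ OnlyNonposRoots G ∧ VeeS F G

/-- `F` is extremal (in `𝓡̄_n(q)` or `𝓝̄_n(q)`): `F(z) = c · R_n(q; a z)` for
nonzero reals `a`, `c`. -/
def Extremal (n : ℕ) (q : ℝ) (F : Polynomial ℝ) : Prop :=
  ∃ a c : ℝ, a ≠ 0 ∧ c ≠ 0 ∧
    F = Polynomial.C c * (Rpoly n q).comp (Polynomial.C a * Polynomial.X)

/-- The q-difference operator `Δ_{q,n}`. -/
def qDelta (q : ℝ) (n : ℕ) (F : Polynomial ℝ) : Polynomial ℝ :=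
  if q = 1 then Polynomial.C ((n : ℝ)⁻¹) * Polynomial.derivative F
  else Polynomial.C (q ^ (n - 1) - q⁻¹)⁻¹ *
    (F - F.comp (Polynomial.C q⁻¹ * Polynomial.X)).divX

/-- The operator `Δ*_{q,n}`. -/
def qDeltaStar (q : ℝ) (n : ℕ) (F : Polynomial ℝ) : Polynomial ℝ :=
  if q = 1 then F - Polynomial.C ((n : ℝ)⁻¹) * (Polynomial.X * Polynomial.derivative F)
  else Polynomial.C (q⁻¹ ^ n - 1)⁻¹ *
    (Polynomial.C (q⁻¹ ^ n) * F - F.comp (Polynomial.C q⁻¹ * Polynomial.X))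

/-- The sequence `a_0, …, a_n` is strictly log-concave (`𝓛𝓒_n`):
`a_k² > a_{k-1} a_{k+1}` for every `k` for which there are `l ≤ k` and `m ≥ k`
with `a_l ≠ 0 ≠ a_m` (with the convention `a_{-1} = 0`). -/
def LCcond (n : ℕ) (a : ℕ → ℝ) : Prop :=
  ∀ k ≤ n, (∃ l, l ≤ k ∧ a l ≠ 0) → (∃ m, k ≤ m ∧ m ≤ n ∧ a m ≠ 0) →
    (if k = 0 then (0 : ℝ) else a (k - 1)) * a (k + 1) < a k ^ 2

/-- `σ_n(ℝ)`: the zero polynomial together with the polynomials of degree `n` or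
`n-1` with only real, simple zeros. -/
def sigmaR (n : ℕ) (P : Polynomial ℝ) : Prop :=
  P = 0 ∨ ((P.natDegree = n ∨ P.natDegree + 1 = n) ∧
    P.roots.card = P.natDegree ∧ ∀ x ∈ P.roots, P.roots.count x = 1)

/-- `P` and `Q` have strictly interspersed zeros: `P'Q - PQ'` never vanishes. -/
def StrictInt (P Q : Polynomial ℝ) : Prop :=
  ∀ t : ℝ, (Polynomial.derivative P * Q - P * Polynomial.derivative Q).eval t ≠ 0

end

/-- The Bezoutian kernel of two real polynomials on the diagonal `(z, conj z)`: the Wronskian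
`B'A - BA'` at real points, and `Im (B(z) * conj A(z)) / Im z` elsewhere. -/
noncomputable def bez (z : ℂ) (B A : ℝ[X]) : ℝ :=
  if z.im = 0 then (derivative B * A - B * derivative A).eval z.re
  else (aeval z B * (starRingEnd ℂ) (aeval z A)).im / z.im

/-- The squared modulus of `A(z)`. -/
noncomputable def sqAbs (z : ℂ) (A : ℝ[X]) : ℝ := Complex.normSq (aeval z A)

lemma aeval_ofReal_re {z : ℂ} (hz : z.im = 0) (A : ℝ[X]) :
    aeval z A = ((A.eval z.re : ℝ) : ℂ) := by
  have : z = (algebraMap ℝ ℂ) z.re := by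
    apply Complex.ext <;> simp [hz]
  conv_lhs => rw [this]
  rw [aeval_algebraMap_apply]
  simp

lemma aeval_eq_zero_iff_of_im_eq_zero {z : ℂ} (hz : z.im = 0) (A : ℝ[X]) :
    aeval z A = 0 ↔ A.eval z.re = 0 := by
  rw [aeval_ofReal_re hz]; simp

lemma sqAbs_nonneg (z : ℂ) (A : ℝ[X]) : 0 ≤ sqAbs z A := Complex.normSq_nonneg _

lemma sqAbs_pos {z : ℂ} {A : ℝ[X]} (h : aeval z A ≠ 0) : 0 < sqAbs z A :=
  Complex.normSq_pos.2 h

lemma sqAbs_eq_zero {z : ℂ} {A : ℝ[X]} : sqAbs z A = 0 ↔ aeval z A = 0 := Complex.normSq_eq_zero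

lemma bez_add_left (z : ℂ) (B₁ B₂ A : ℝ[X]) : bez z (B₁ + B₂) A = bez z B₁ A + bez z B₂ A := by
  unfold bez
  split_ifs
  · simp; ring
  · simp [Complex.add_im, Complex.mul_im]; ring

lemma bez_C_mul_left (z : ℂ) (c : ℝ) (B A : ℝ[X]) : bez z (C c * B) A = c * bez z B A := by
  unfold bez
  split_ifs
  · simp; ring
  · simp [Complex.mul_im]; ring

lemma bez_antisymm (z : ℂ) (B A : ℝ[X]) : bez z A B = - bez z B A := by
  unfold bez
  split_ifs
  · simp; ring
  · simp [Complex.mul_im]; ring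

lemma bez_self (z : ℂ) (A : ℝ[X]) : bez z A A = 0 := by
  have := bez_antisymm z A A
  linarith

lemma bez_add_right (z : ℂ) (B A₁ A₂ : ℝ[X]) : bez z B (A₁ + A₂) = bez z B A₁ + bez z B A₂ := by
  rw [bez_antisymm, bez_add_left, bez_antisymm z A₁, bez_antisymm z A₂]; ring

lemma bez_C_mul_right (z : ℂ) (c : ℝ) (B A : ℝ[X]) : bez z B (C c * A) = c * bez z B A := by
  rw [bez_antisymm, bez_C_mul_left, bez_antisymm z A]; ring

lemma bez_zero_left (z : ℂ) (A : ℝ[X]) : bez z 0 A = 0 := by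
  simpa using bez_C_mul_left z 0 0 A

lemma bez_zero_right (z : ℂ) (A : ℝ[X]) : bez z A 0 = 0 := by
  simpa using bez_C_mul_right z 0 A 0

lemma bez_sum_left {ι : Type*} (z : ℂ) (s : Finset ι) (B : ι → ℝ[X]) (A : ℝ[X]) :
    bez z (∑ i ∈ s, B i) A = ∑ i ∈ s, bez z (B i) A := by
  induction s using Finset.induction_on with
  | empty => simp [bez_zero_left]
  | insert a s ha ih => rw [Finset.sum_insert ha, Finset.sum_insert ha, bez_add_left, ih]

lemma bez_sum_right {ι : Type*} (z : ℂ) (s : Finset ι) (B : ι → ℝ[X]) (A : ℝ[X]) :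
    bez z A (∑ i ∈ s, B i) = ∑ i ∈ s, bez z A (B i) := by
  rw [bez_antisymm, bez_sum_left, ← Finset.sum_neg_distrib]
  exact Finset.sum_congr rfl fun i _ => (bez_antisymm _ _ _).symm

lemma bez_self_X_mul (z : ℂ) (A : ℝ[X]) : bez z A (X * A) = - sqAbs z A := by
  unfold bez sqAbs
  split_ifs with h
  · rw [aeval_ofReal_re h]
    simp; ring
  · rw [div_eq_iff h]
    simp [Complex.mul_im, Complex.normSq_apply]; ring

lemma bez_X_mul_X_mul (z : ℂ) (B A : ℝ[X]) :
    bez z (X * B) (X * A) = Complex.normSq z * bez z B A := by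
  unfold bez
  split_ifs with h
  · simp [Complex.normSq_apply, h]; ring
  · simp [Complex.mul_im, Complex.normSq_apply]; ring

lemma bez_comp_scale (z : ℂ) {a : ℝ} (ha : a ≠ 0) (B A : ℝ[X]) :
    bez z (B.comp (C a * X)) (A.comp (C a * X)) = a * bez (a * z) B A := by
  have key : ∀ P : ℝ[X], aeval z (P.comp (C a * X)) = aeval ((a : ℂ) * z) P := by
    intro P
    rw [aeval_comp]; simp
  unfold bez
  have him : ((a : ℂ) * z).im = a * z.im := by simp [Complex.mul_im]
  have hre : ((a : ℂ) * z).re = a * z.re := by simp [Complex.mul_re]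
  rw [him, hre]
  by_cases h : z.im = 0
  · simp [h, derivative_comp]; ring
  · rw [if_neg h, if_neg (mul_ne_zero ha h), key, key]
    field_simp

lemma bez_eq_zero_of_common {z : ℂ} {B A : ℝ[X]} (hB : aeval z B = 0) (hA : aeval z A = 0) :
    bez z B A = 0 := by
  unfold bez
  split_ifs with h
  · rw [aeval_eq_zero_iff_of_im_eq_zero h] at hA hB
    simp [hA, hB]
  · simp [hA]

lemma bez_eq_zero_of_nonreal {z : ℂ} {B A : ℝ[X]} (hz : z.im ≠ 0) (hB : aeval z B = 0) :
    bez z B A = 0 := by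
  simp [bez, hz, hB]

lemma bez_ofReal (x : ℝ) (B A : ℝ[X]) :
    bez x B A = (derivative B).eval x * A.eval x - B.eval x * (derivative A).eval x := by
  simp [bez]

/-- A real polynomial without nonreal zeros has only real zeros. -/
lemma card_roots_of_forall_nonreal {P : ℝ[X]} (hP : P ≠ 0)
    (h : ∀ z : ℂ, z.im ≠ 0 → aeval z P ≠ 0) : P.roots.card = P.natDegree := by
  induction hn : P.natDegree generalizing P with
  | zero =>
    rw [eq_C_of_natDegree_eq_zero hn]; simp
  | succ n ih =>
    have hdeg : 0 < (P.map (algebraMap ℝ ℂ)).degree := by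
      rw [degree_map, ← natDegree_pos_iff_degree_pos]; omega
    obtain ⟨z, hz⟩ := Complex.exists_root hdeg
    have hz' : aeval z P = 0 := by rwa [IsRoot.def, eval_map_algebraMap] at hz
    have him : z.im = 0 := by
      by_contra h0; exact h z h0 hz'
    rw [aeval_eq_zero_iff_of_im_eq_zero him] at hz'
    obtain ⟨R, rfl⟩ := dvd_iff_isRoot.2 hz'
    have hR : R ≠ 0 := right_ne_zero_of_mul hP
    rw [natDegree_mul (X_sub_C_ne_zero _) hR, natDegree_X_sub_C] at hn
    rw [roots_mul hP, Multiset.card_add, roots_X_sub_C, Multiset.card_singleton,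
      ih hR (fun w hw h0 => h w hw (by simp [h0])) (by omega)]
    omega

lemma aeval_ne_zero_of_card_roots {P : ℝ[X]} (hP : P ≠ 0) (h : P.roots.card = P.natDegree)
    {z : ℂ} (hz : z.im ≠ 0) : aeval z P ≠ 0 := by
  rw [← C_leadingCoeff_mul_prod_multiset_X_sub_C h, map_mul, map_multiset_prod]
  refine mul_ne_zero (by simpa using hP) ?_
  refine Multiset.prod_ne_zero ?_
  simp only [Multiset.map_map, Multiset.mem_map, not_exists, not_and]
  intro x _ h0
  apply hz
  have : z = (x : ℂ) := by simpa [sub_eq_zero] using h0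
  simp [this]

lemma natDegree_divByMonic_X_sub_C (P : ℝ[X]) (y : ℝ) :
    (P /ₘ (X - C y)).natDegree = P.natDegree - 1 := by
  rw [natDegree_divByMonic _ (monic_X_sub_C y), natDegree_X_sub_C]

lemma X_sub_C_mul_divByMonic {P : ℝ[X]} {y : ℝ} (hy : y ∈ P.roots) :
    (X - C y) * (P /ₘ (X - C y)) = P :=
  mul_divByMonic_eq_iff_isRoot.2 (isRoot_of_mem_roots hy)

lemma divByMonic_ne_zero {P : ℝ[X]} {y : ℝ} (hy : y ∈ P.roots) : P /ₘ (X - C y) ≠ 0 := by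
  intro h
  have := X_sub_C_mul_divByMonic hy
  rw [h, mul_zero] at this
  rw [← this] at hy
  simp at hy

lemma roots_divByMonic {P : ℝ[X]} {y : ℝ} (hy : y ∈ P.roots) :
    P.roots = y ::ₘ (P /ₘ (X - C y)).roots := by
  conv_lhs => rw [← X_sub_C_mul_divByMonic hy]
  rw [roots_mul (mul_ne_zero (X_sub_C_ne_zero _) (divByMonic_ne_zero hy)), roots_X_sub_C]
  rfl

lemma card_roots_divByMonic {P : ℝ[X]} {y : ℝ} (hy : y ∈ P.roots)
    (h : P.roots.card = P.natDegree) :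
    (P /ₘ (X - C y)).roots.card = (P /ₘ (X - C y)).natDegree := by
  rw [natDegree_divByMonic_X_sub_C, ← h, roots_divByMonic hy]
  simp

lemma bez_X_sub_C_mul (z : ℂ) (y : ℝ) (Q : ℝ[X]) : bez z Q ((X - C y) * Q) = - sqAbs z Q := by
  rw [show (X - C y) * Q = X * Q + C (-y) * Q by rw [C_neg]; ring, bez_add_right,
    bez_self_X_mul, bez_C_mul_right, bez_self]
  ring

lemma bez_divByMonic {P : ℝ[X]} {y : ℝ} (hy : y ∈ P.roots) (z : ℂ) :
    bez z (P /ₘ (X - C y)) P = - sqAbs z (P /ₘ (X - C y)) := by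
  have := bez_X_sub_C_mul z y (P /ₘ (X - C y))
  rwa [X_sub_C_mul_divByMonic hy] at this

lemma sqAbs_sum_le {ι : Type*} (z : ℂ) (s : Finset ι) (w : ι → ℝ) (hw : ∀ i, 0 ≤ w i)
    (A : ι → ℝ[X]) :
    sqAbs z (∑ i ∈ s, C (w i) * A i) ≤ (∑ i ∈ s, w i) * ∑ i ∈ s, w i * sqAbs z (A i) := by
  unfold sqAbs
  rw [Complex.normSq_eq_norm_sq]
  have h1 : ‖aeval z (∑ i ∈ s, C (w i) * A i)‖ ≤ ∑ i ∈ s, w i * ‖aeval z (A i)‖ := by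
    rw [map_sum]
    refine (norm_sum_le _ _).trans (Finset.sum_le_sum fun i _ => ?_)
    simp [abs_of_nonneg (hw i)]
  calc ‖aeval z (∑ i ∈ s, C (w i) * A i)‖ ^ 2 ≤ (∑ i ∈ s, w i * ‖aeval z (A i)‖) ^ 2 := by gcongr
    _ ≤ _ := by
      apply Finset.sum_sq_le_sum_mul_sum_of_sq_le_mul
      · intro i _; exact hw i
      · intro i _; exact mul_nonneg (hw i) (Complex.normSq_nonneg _)
      · intro i _; rw [Complex.normSq_eq_norm_sq]; apply le_of_eq; ring

/-- The q-number `1 + q + ⋯ + q^(k-1)`. -/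
noncomputable def qNum (q : ℝ) (k : ℕ) : ℝ := ∑ i ∈ Finset.range k, q ^ i

lemma qNum_zero (q : ℝ) : qNum q 0 = 0 := by simp [qNum]

lemma qNum_succ (q : ℝ) (k : ℕ) : qNum q (k + 1) = qNum q k + q ^ k := by
  simp [qNum, Finset.sum_range_succ]

lemma qNum_succ' (q : ℝ) (k : ℕ) : qNum q (k + 1) = 1 + q * qNum q k := by
  rw [qNum, Finset.sum_range_succ', qNum, Finset.mul_sum, add_comm]
  simp [pow_succ, mul_comm]

lemma qNum_pos {q : ℝ} (hq : 0 < q) (k : ℕ) : 0 < qNum q (k + 1) := by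
  apply Finset.sum_pos (fun i _ => by positivity); simp

lemma qNum_nonneg {q : ℝ} (hq : 0 < q) (k : ℕ) : 0 ≤ qNum q k :=
  Finset.sum_nonneg fun i _ => by positivity

lemma qNum_sub_add {q : ℝ} (hq : 0 < q) {n k : ℕ} (hk : k ≤ n + 1) :
    qNum q (n + 1 - k) + q ^ n * qNum q⁻¹ k = qNum q (n + 1) := by
  induction k with
  | zero => simp [qNum_zero]
  | succ k ih =>
    obtain ⟨m, rfl⟩ := Nat.exists_eq_add_of_le (show k ≤ n by omega)
    have := ih (by omega)
    rw [show k + m + 1 - k = m + 1 by omega, qNum_succ] at this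
    rw [show k + m + 1 - (k + 1) = m by omega, qNum_succ _ k, ← this, mul_add, inv_pow,
      show q ^ (k + m) * (q ^ k)⁻¹ = q ^ m by field_simp; rw [pow_add]]
    ring

lemma Rpoly_succ (n : ℕ) (q : ℝ) : Rpoly (n + 1) q = Rpoly n q * (1 + C (q ^ n) * X) := by
  rw [Rpoly, Finset.prod_range_succ, Rpoly]

lemma qBinom_zero_right (n : ℕ) (q : ℝ) : qBinom n 0 q = 1 := by
  induction n with
  | zero => simp [qBinom, Rpoly]
  | succ n ih => simp_all [qBinom, Rpoly_succ]

lemma qBinom_succ_succ (n k : ℕ) (q : ℝ) :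
    qBinom (n + 1) (k + 1) q = qBinom n (k + 1) q + q ^ n * qBinom n k q := by
  rw [qBinom, Rpoly_succ, show Rpoly n q * (1 + C (q ^ n) * X)
    = Rpoly n q + C (q ^ n) * (Rpoly n q * X) by ring, coeff_add, coeff_C_mul, coeff_mul_X]
  rfl

lemma qBinom_eq_zero {n k : ℕ} (q : ℝ) (h : n < k) : qBinom n k q = 0 := by
  induction n generalizing k with
  | zero => simp [qBinom, Rpoly, coeff_one]; omega
  | succ n ih =>
    obtain ⟨k, rfl⟩ : ∃ j, k = j + 1 := ⟨k - 1, by omega⟩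
    rw [qBinom_succ_succ, ih (by omega), ih (by omega)]; simp

lemma qBinom_nonneg {q : ℝ} (hq : 0 < q) (n k : ℕ) : 0 ≤ qBinom n k q := by
  induction n generalizing k with
  | zero => simp [qBinom, Rpoly, coeff_one]; split_ifs <;> simp
  | succ n ih =>
    rcases k with _ | k
    · simp [qBinom_zero_right]
    · rw [qBinom_succ_succ]
      have := ih k; have := ih (k + 1); positivity

lemma qBinom_pos {q : ℝ} (hq : 0 < q) {n k : ℕ} (h : k ≤ n) : 0 < qBinom n k q := by
  induction n generalizing k with
  | zero => obtain rfl : k = 0 := by omega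
            simp [qBinom_zero_right]
  | succ n ih =>
    rcases k with _ | k
    · simp [qBinom_zero_right]
    · rw [qBinom_succ_succ]
      have := ih (k := k) (by omega)
      have := qBinom_nonneg hq n (k + 1); positivity

lemma qNum_inv_mul_qBinom {q : ℝ} (hq : 0 < q) (n k : ℕ) :
    qNum q⁻¹ (k + 1) * qBinom (n + 1) (k + 1) q = qNum q (n + 1) * qBinom n k q := by
  induction n generalizing k with
  | zero =>
    rw [qBinom_succ_succ, qBinom_eq_zero q (show 0 < k + 1 by omega)]
    rcases k with _ | k
    · simp [qNum, qBinom_zero_right]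
    · simp [qBinom_eq_zero q (show 0 < k + 1 by omega)]
  | succ n ih =>
    rw [qBinom_succ_succ, mul_add, ih, qNum_succ' q⁻¹ k, qNum_succ _ (n + 1)]
    rcases k with _ | k
    · simp [qNum_zero, qBinom_zero_right]
    · have h1 := ih k
      have h2 := qBinom_succ_succ n k q
      have h3 : q * q⁻¹ = 1 := by field_simp
      linear_combination (q ^ n) * h1 - (qNum q (n + 1)) * h2
        + (q ^ n * qNum q⁻¹ (k + 1) * qBinom (n + 1) (k + 1) q) * h3

lemma qNum_mul_qBinom {q : ℝ} (hq : 0 < q) {n k : ℕ} (hk : k ≤ n) :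
    qNum q (n + 1 - k) * qBinom (n + 1) k q = qNum q (n + 1) * qBinom n k q := by
  rcases k with _ | k
  · simp [qBinom_zero_right]
  · have h1 := qNum_inv_mul_qBinom hq n k
    have h2 := qBinom_succ_succ n k q
    have h3 := qNum_sub_add hq (show k + 1 ≤ n + 1 by omega)
    linear_combination (-q ^ n) * h1 + (qNum q (n + 1)) * h2 + (qBinom (n + 1) (k + 1) q) * h3

/-- The `q`-derivative sending `X^(k+1)` to `(1 + q⁻¹ + ⋯ + q^(-k)) X^k`. -/
noncomputable def dq (q : ℝ) (F : ℝ[X]) : ℝ[X] :=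
  ∑ k ∈ Finset.range F.natDegree, C (F.coeff (k + 1) * qNum q⁻¹ (k + 1)) * X ^ k

lemma coeff_dq (q : ℝ) (F : ℝ[X]) (k : ℕ) :
    (dq q F).coeff k = F.coeff (k + 1) * qNum q⁻¹ (k + 1) := by
  simp only [dq, finsetSum_coeff, coeff_C_mul, coeff_X_pow, mul_ite, mul_one, mul_zero,
    Finset.sum_ite_eq, Finset.mem_range]
  split_ifs with h
  · rfl
  · rw [coeff_eq_zero_of_natDegree_lt (by omega)]; simp

lemma dq_add (q : ℝ) (F G : ℝ[X]) : dq q (F + G) = dq q F + dq q G := by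
  ext k; simp [coeff_dq]; ring

lemma dq_C_mul (q c : ℝ) (F : ℝ[X]) : dq q (C c * F) = C c * dq q F := by
  ext k; simp [coeff_dq]; ring

lemma dq_zero (q : ℝ) : dq q 0 = 0 := by ext k; simp [coeff_dq]

lemma dq_C (q c : ℝ) : dq q (C c) = 0 := by ext k; simp [coeff_dq]

lemma dq_one (F : ℝ[X]) : dq 1 F = derivative F := by
  ext k; simp [coeff_dq, coeff_derivative, qNum]

lemma dq_X_mul (q : ℝ) (F : ℝ[X]) : dq q (X * F) = F + C q⁻¹ * (X * dq q F) := by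
  ext k
  rcases k with _ | k
  · simp [coeff_dq, qNum]
  · simp [coeff_dq, qNum_succ' q⁻¹ (k + 1)]; ring

lemma dq_X_sub_C_mul {q : ℝ} (hq : 0 < q) (x : ℝ) (F : ℝ[X]) :
    dq q ((X - C x) * F) = F + C q⁻¹ * ((X - C (q * x)) * dq q F) := by
  rw [show (X - C x) * F = X * F + C (-x) * F by rw [C_neg]; ring, dq_add, dq_X_mul, dq_C_mul]
  have : C x = C q⁻¹ * C (q * x) := by rw [← C_mul]; congr 1; field_simp
  rw [C_neg, this]; ring

lemma natDegree_dq_le (q : ℝ) (F : ℝ[X]) : (dq q F).natDegree ≤ F.natDegree - 1 := by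
  rw [natDegree_le_iff_coeff_eq_zero]
  intro k hk
  rw [coeff_dq, coeff_eq_zero_of_natDegree_lt (by omega), zero_mul]

/-- Scaling by `q⁻¹` in terms of the `q`-derivative. -/
lemma comp_inv_mul {q : ℝ} (hq : 0 < q) (F : ℝ[X]) :
    F.comp (C q⁻¹ * X) = F + C ((1 - q) / q) * (X * dq q F) := by
  ext k
  rw [comp_C_mul_X_coeff]
  rcases k with _ | k
  · simp
  · simp only [coeff_add, coeff_C_mul, coeff_X_mul, coeff_dq]
    have : ∀ m, (q⁻¹) ^ m = 1 + (1 - q) / q * qNum q⁻¹ m := by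
      intro m
      induction m with
      | zero => simp [qNum_zero]
      | succ m ih =>
        rw [qNum_succ', pow_succ, ih]; field_simp; ring
    rw [this]; ring

/-- The shift of `F` from level `n + 1` to level `n`: on coefficients
`a_k` with respect to the `q`-binomial basis, this is `a_k ↦ a_(k+1)`. -/
noncomputable def shiftUp (n : ℕ) (q : ℝ) (F : ℝ[X]) : ℝ[X] := C (qNum q (n + 1))⁻¹ * dq q F

/-- The truncation of `F` from level `n + 1` to level `n`: on coefficients with respect to the
`q`-binomial basis, this forgets the last coefficient. -/
noncomputable def trunc (n : ℕ) (q : ℝ) (F : ℝ[X]) : ℝ[X] :=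
  F - C (q ^ n) * (X * shiftUp n q F)

lemma trunc_eq (n : ℕ) (q : ℝ) (F : ℝ[X]) :
    trunc n q F = F - C (q ^ n / qNum q (n + 1)) * (X * dq q F) := by
  rw [trunc, shiftUp, div_eq_mul_inv, C_mul]; ring

lemma coeff_trunc {q : ℝ} (hq : 0 < q) {n k : ℕ} (hk : k ≤ n + 1) (F : ℝ[X]) :
    (trunc n q F).coeff k = F.coeff k * (qNum q (n + 1 - k) / qNum q (n + 1)) := by
  have hb := (qNum_pos hq n).ne'
  rw [trunc_eq]
  rcases k with _ | k
  · simp [div_self hb]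
  · have := qNum_sub_add hq hk
    simp only [coeff_sub, coeff_C_mul, coeff_X_mul, coeff_dq]
    generalize qNum q (n + 1 - (k + 1)) = u at *
    generalize qNum q⁻¹ (k + 1) = v at *
    generalize qNum q (n + 1) = b at *
    field_simp
    linear_combination (-F.coeff (k + 1)) * this

lemma coeff_shiftUp (n : ℕ) (q : ℝ) (F : ℝ[X]) (k : ℕ) :
    (shiftUp n q F).coeff k = F.coeff (k + 1) * (qNum q⁻¹ (k + 1) / qNum q (n + 1)) := by
  simp [shiftUp, coeff_dq]; ring

lemma natDegree_shiftUp_le {n : ℕ} (q : ℝ) {F : ℝ[X]} (hF : F.natDegree ≤ n + 1) :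
    (shiftUp n q F).natDegree ≤ n :=
  (natDegree_C_mul_le _ _).trans ((natDegree_dq_le q F).trans (by omega))

lemma natDegree_trunc_le {q : ℝ} (hq : 0 < q) {n : ℕ} {F : ℝ[X]} (hF : F.natDegree ≤ n + 1) :
    (trunc n q F).natDegree ≤ n := by
  rw [natDegree_le_iff_coeff_eq_zero]
  intro k hk
  rcases (show n + 1 ≤ k from hk).eq_or_lt with rfl | hk
  · simp [coeff_trunc hq le_rfl, qNum_zero]
  · rw [trunc, coeff_sub, coeff_C_mul, coeff_eq_zero_of_natDegree_lt (by omega)]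
    obtain ⟨k, rfl⟩ : ∃ j, k = j + 1 := ⟨k - 1, by omega⟩
    rw [coeff_X_mul, coeff_eq_zero_of_natDegree_lt
      ((natDegree_shiftUp_le q hF).trans_lt (by omega))]
    simp

lemma coeff_qHadamard (n : ℕ) (q : ℝ) (F G : ℝ[X]) (k : ℕ) :
    (qHadamard n q F G).coeff k = F.coeff k * G.coeff k / qBinom n k q := by
  simp only [qHadamard, finsetSum_coeff, coeff_C_mul, coeff_X_pow, mul_ite, mul_one, mul_zero,
    Finset.sum_ite_eq, Finset.mem_range]
  split_ifs with h
  · rfl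
  · rw [qBinom_eq_zero q (by omega)]; simp

lemma natDegree_qHadamard_le (n : ℕ) (q : ℝ) (F G : ℝ[X]) :
    (qHadamard n q F G).natDegree ≤ n := by
  rw [natDegree_le_iff_coeff_eq_zero]
  intro k hk
  rw [coeff_qHadamard, qBinom_eq_zero q hk, div_zero]

lemma qHadamard_comm (n : ℕ) (q : ℝ) (F G : ℝ[X]) : qHadamard n q F G = qHadamard n q G F := by
  ext k; simp [coeff_qHadamard, mul_comm]

lemma qHadamard_add_left (n : ℕ) (q : ℝ) (F₁ F₂ G : ℝ[X]) :
    qHadamard n q (F₁ + F₂) G = qHadamard n q F₁ G + qHadamard n q F₂ G := by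
  ext k; simp [coeff_qHadamard]; ring

lemma qHadamard_C_mul_left (n : ℕ) (q c : ℝ) (F G : ℝ[X]) :
    qHadamard n q (C c * F) G = C c * qHadamard n q F G := by
  ext k; simp [coeff_qHadamard]; ring

lemma qHadamard_zero_left (n : ℕ) (q : ℝ) (G : ℝ[X]) : qHadamard n q 0 G = 0 := by
  ext k; simp [coeff_qHadamard]

lemma qHadamard_C_mul_right (n : ℕ) (q c : ℝ) (F G : ℝ[X]) :
    qHadamard n q F (C c * G) = C c * qHadamard n q F G := by
  rw [qHadamard_comm, qHadamard_C_mul_left, qHadamard_comm]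

lemma qHadamard_add_right (n : ℕ) (q : ℝ) (F G₁ G₂ : ℝ[X]) :
    qHadamard n q F (G₁ + G₂) = qHadamard n q F G₁ + qHadamard n q F G₂ := by
  rw [qHadamard_comm, qHadamard_add_left, qHadamard_comm n q F, qHadamard_comm n q F]

lemma qHadamard_sum_left {ι : Type*} (n : ℕ) (q : ℝ) (s : Finset ι) (F : ι → ℝ[X]) (G : ℝ[X]) :
    qHadamard n q (∑ i ∈ s, F i) G = ∑ i ∈ s, qHadamard n q (F i) G := by
  induction s using Finset.induction_on with
  | empty => simp [qHadamard_zero_left]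
  | insert a s ha ih => rw [Finset.sum_insert ha, Finset.sum_insert ha, qHadamard_add_left, ih]

lemma qHadamard_eq_trunc {q : ℝ} (hq : 0 < q) {n : ℕ} {H : ℝ[X]} (hH : H.natDegree ≤ n)
    (G : ℝ[X]) : qHadamard (n + 1) q H G = qHadamard n q H (trunc n q G) := by
  ext k
  rw [coeff_qHadamard, coeff_qHadamard]
  by_cases hk : k ≤ n
  · rw [coeff_trunc hq (by omega)]
    have h1 := qNum_mul_qBinom hq hk
    have h2 := (qBinom_pos hq hk).ne'
    have h3 := (qBinom_pos hq (show k ≤ n + 1 by omega)).ne'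
    have h4 := (qNum_pos hq n).ne'
    field_simp
    linear_combination (- H.coeff k * G.coeff k) * h1
  · rw [coeff_eq_zero_of_natDegree_lt (by omega)]; simp

lemma qHadamard_X_mul {q : ℝ} (hq : 0 < q) (n : ℕ) (H G : ℝ[X]) :
    qHadamard (n + 1) q (X * H) G = X * qHadamard n q H (shiftUp n q G) := by
  ext k
  rcases k with _ | k
  · simp [coeff_qHadamard]
  · rw [coeff_X_mul, coeff_qHadamard, coeff_qHadamard, coeff_X_mul]
    by_cases hk : k ≤ n
    · rw [coeff_shiftUp]
      have h1 := qNum_inv_mul_qBinom hq n k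
      have h2 := (qBinom_pos hq hk).ne'
      have h3 := (qBinom_pos hq (show k + 1 ≤ n + 1 by omega)).ne'
      have h4 := (qNum_pos hq n).ne'
      generalize qNum q⁻¹ (k + 1) = v at *
      field_simp
      linear_combination (- H.coeff k * G.coeff (k + 1)) * h1
    · rw [qBinom_eq_zero q (by omega), qBinom_eq_zero q (by omega)]; simp

lemma qHadamard_X_sub_C_mul {q : ℝ} (hq : 0 < q) {n : ℕ} {H : ℝ[X]} (hH : H.natDegree ≤ n)
    (x : ℝ) (G : ℝ[X]) : qHadamard (n + 1) q ((X - C x) * H) G =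
      X * qHadamard n q H (shiftUp n q G) + C (-x) * qHadamard n q H (trunc n q G) := by
  rw [show (X - C x) * H = X * H + C (-x) * H by rw [C_neg]; ring, qHadamard_add_left,
    qHadamard_X_mul hq, qHadamard_C_mul_left, qHadamard_eq_trunc hq hH]

lemma X_mul_dq_qHadamard (n : ℕ) (q : ℝ) (F G : ℝ[X]) :
    X * dq q (qHadamard n q F G) = qHadamard n q (X * dq q F) G := by
  ext k
  rcases k with _ | k
  · simp [coeff_qHadamard]
  · rw [coeff_X_mul, coeff_dq, coeff_qHadamard, coeff_qHadamard, coeff_X_mul, coeff_dq]; ring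

/-- Nonnegative combinations of the quotients of `F` by its linear factors. -/
def InCone (F P : ℝ[X]) : Prop :=
  ∃ w : ℝ → ℝ, (∀ y, 0 ≤ w y) ∧ P = ∑ y ∈ F.roots.toFinset, C (w y) * (F /ₘ (X - C y))

lemma InCone.add {F P Q : ℝ[X]} (hP : InCone F P) (hQ : InCone F Q) : InCone F (P + Q) := by
  obtain ⟨w, hw, rfl⟩ := hP
  obtain ⟨v, hv, rfl⟩ := hQ
  refine ⟨fun y => w y + v y, fun y => add_nonneg (hw y) (hv y), ?_⟩
  simp [add_mul, Finset.sum_add_distrib]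

lemma InCone.C_mul {F P : ℝ[X]} (hP : InCone F P) {c : ℝ} (hc : 0 ≤ c) : InCone F (C c * P) := by
  obtain ⟨w, hw, rfl⟩ := hP
  refine ⟨fun y => c * w y, fun y => mul_nonneg hc (hw y), ?_⟩
  simp [Finset.mul_sum, mul_assoc]

lemma InCone.zero (F : ℝ[X]) : InCone F 0 := ⟨fun _ => 0, by simp, by simp⟩

lemma InCone.sum {ι : Type*} {F : ℝ[X]} (s : Finset ι) (P : ι → ℝ[X])
    (h : ∀ i ∈ s, InCone F (P i)) : InCone F (∑ i ∈ s, P i) := by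
  induction s using Finset.induction_on with
  | empty => simpa using InCone.zero F
  | insert a s ha ih =>
    rw [Finset.sum_insert ha]
    exact (h a (by simp)).add (ih fun i hi => h i (by simp [hi]))

lemma InCone.divByMonic {F : ℝ[X]} {y : ℝ} (hy : y ∈ F.roots) :
    InCone F (F /ₘ (X - C y)) := by
  refine ⟨fun x => if x = y then 1 else 0, fun x => ?_, ?_⟩
  · dsimp only; split_ifs <;> simp
  rw [Finset.sum_eq_single y]
  · simp
  · intro b _ hb; simp [hb]
  · intro h; exact absurd (Multiset.mem_toFinset.2 hy) h

lemma divByMonic_eq_of_eq_mul {F Q : ℝ[X]} {y : ℝ} (h : F = (X - C y) * Q) :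
    F /ₘ (X - C y) = Q := by
  rw [h, mul_divByMonic_cancel_left _ (monic_X_sub_C y)]

lemma LogSep.of_le {q : ℝ} {s t : Multiset ℝ} (h : LogSep q t) (hst : s ≤ t) : LogSep q s :=
  ⟨fun x hx hx0 h2 => h.1 x (Multiset.mem_of_le hst hx) hx0 (h2.trans (Multiset.count_le_of_le x hst)),
    fun x hx y hy => h.2 x (Multiset.mem_of_le hst hx) y (Multiset.mem_of_le hst hy)⟩

lemma StrictLogSep.of_le {q : ℝ} {s t : Multiset ℝ} (h : StrictLogSep q t) (hst : s ≤ t) :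
    StrictLogSep q s :=
  ⟨fun x hx hx0 h2 => h.1 x (Multiset.mem_of_le hst hx) hx0 (h2.trans (Multiset.count_le_of_le x hst)),
    fun x hx y hy => h.2 x (Multiset.mem_of_le hst hx) y (Multiset.mem_of_le hst hy)⟩

lemma StrictLogSep.logSep {q : ℝ} {s : Multiset ℝ} (h : StrictLogSep q s) : LogSep q s :=
  ⟨fun x hx hx0 h2 => (h.1 x hx hx0 h2).le, fun x hx y hy h' => (h.2 x hx y hy h').le⟩

/-- The `q`-derivative of a polynomial with logarithmically `q`-separated zeros is a nonnegative
combination of the quotients by its linear factors. -/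
lemma inCone_dq {q : ℝ} (hq : 0 < q) (hq1 : q ≤ 1) {F : ℝ[X]} (hF : F ≠ 0)
    (hs : F.roots.card = F.natDegree) (hsep : LogSep q F.roots) : InCone F (dq q F) := by
  induction hn : F.natDegree generalizing F with
  | zero =>
    rw [eq_C_of_natDegree_eq_zero hn, dq_C]; exact InCone.zero _
  | succ n ih =>
    have hne : F.roots.toFinset.Nonempty := by
      rw [Multiset.toFinset_nonempty]
      intro h; rw [h, Multiset.card_zero] at hs; omega
    obtain ⟨x, hx, hmax⟩ := Finset.exists_max_image _ (fun y : ℝ => |y|) hne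
    rw [Multiset.mem_toFinset] at hx
    obtain ⟨H, hH⟩ : ∃ H, H = F /ₘ (X - C x) := ⟨_, rfl⟩
    have hFH : F = (X - C x) * H := by rw [hH, X_sub_C_mul_divByMonic hx]
    have hroots : F.roots = x ::ₘ H.roots := by rw [hH]; exact roots_divByMonic hx
    have hH0 : H ≠ 0 := right_ne_zero_of_mul (hFH ▸ hF)
    have hHs : H.roots.card = H.natDegree := by rw [hH]; exact card_roots_divByMonic hx hs
    have hle : H.roots ≤ F.roots := by rw [hroots]; exact Multiset.le_cons_self _ _
    obtain ⟨w, hw, hdq⟩ := ih hH0 hHs (hsep.of_le hle)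
      (by rw [hH, natDegree_divByMonic_X_sub_C]; omega)
    have hHc : InCone F H := by rw [hH]; exact InCone.divByMonic hx
    rw [hFH, dq_X_sub_C_mul hq, ← hFH, hdq, Finset.mul_sum, Finset.mul_sum]
    refine hHc.add (InCone.sum _ _ fun y hy => ?_)
    rw [Multiset.mem_toFinset] at hy
    have hyF := Multiset.mem_of_le hle hy
    have hHy := X_sub_C_mul_divByMonic hy
    set Hy := H /ₘ (X - C y)
    have hFy : InCone F ((X - C x) * Hy) := by
      have h1 : F /ₘ (X - C y) = (X - C x) * Hy := by
        apply divByMonic_eq_of_eq_mul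
        rw [hFH, ← hHy]; ring
      rw [← h1]; exact InCone.divByMonic hyF
    have key : InCone F ((X - C (q * x)) * Hy) := by
      by_cases hyx : y = x
      · have : q * x = x := by
          by_cases hx0 : x = 0
          · simp [hx0]
          · have h2 := hsep.1 x hx hx0 (by
              rw [hroots, Multiset.count_cons_self]
              have := Multiset.one_le_count_iff_mem.2 (hyx ▸ hy); omega)
            rw [le_antisymm hq1 h2, one_mul]
        rwa [this]
      · have hyx' : |y| ≤ |x| := hmax y (Multiset.mem_toFinset.2 hyF)
        have hxy : x - y ≠ 0 := sub_ne_zero.2 (Ne.symm hyx)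
        have hα : 0 ≤ (x - q * x) / (x - y) ∧ 0 ≤ (q * x - y) / (x - y) := by
          rcases lt_trichotomy x 0 with h0 | h0 | h0
          · rw [abs_of_neg h0] at hyx'
            have hlt : x < y := lt_of_le_of_ne (by linarith [neg_abs_le y]) (Ne.symm hyx)
            refine ⟨div_nonneg_of_nonpos (by nlinarith) (by linarith),
              div_nonneg_of_nonpos ?_ (by linarith)⟩
            by_cases hy0 : 0 ≤ y
            · nlinarith
            · have := hsep.2 y hyF x hx (Or.inl ⟨hlt, by linarith⟩)
              rw [div_le_iff_of_neg h0] at this; linarith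
          · rw [h0, abs_zero] at hyx'
            exact absurd (h0 ▸ abs_eq_zero.1 (le_antisymm hyx' (abs_nonneg y))) hyx
          · rw [abs_of_pos h0] at hyx'
            have hlt : y < x := lt_of_le_of_ne (by linarith [le_abs_self y]) hyx
            refine ⟨div_nonneg (by nlinarith) (by linarith), div_nonneg ?_ (by linarith)⟩
            by_cases hy0 : y ≤ 0
            · nlinarith
            · have := hsep.2 y hyF x hx (Or.inr ⟨by linarith, hlt⟩)
              rw [div_le_iff₀ h0] at this; linarith
        have : (X - C (q * x)) * Hy = C ((x - q * x) / (x - y)) * H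
            + C ((q * x - y) / (x - y)) * ((X - C x) * Hy) := by
          rw [← hHy]
          have h1 : C ((x - q * x) / (x - y)) + C ((q * x - y) / (x - y)) = (1 : ℝ[X]) := by
            rw [← C_add, ← C_1]; congr 1; field_simp; ring
          have h2 : C ((x - q * x) / (x - y)) * C y + C ((q * x - y) / (x - y)) * C x
              = C (q * x) := by
            rw [← C_mul, ← C_mul, ← C_add]; congr 1; field_simp; ring
          linear_combination (-X * Hy) * h1 + Hy * h2
        rw [this]
        exact (hHc.C_mul hα.1).add (hFy.C_mul hα.2)
    rw [show C q⁻¹ * ((X - C (q * x)) * (C (w y) * Hy))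
      = C q⁻¹ * (C (w y) * ((X - C (q * x)) * Hy)) by ring]
    exact (key.C_mul (hw y)).C_mul (by positivity)

lemma leadingCoeff_divByMonic_X_sub_C {F : ℝ[X]} {y : ℝ} (hy : y ∈ F.roots) :
    (F /ₘ (X - C y)).leadingCoeff = F.leadingCoeff := by
  conv_rhs => rw [← X_sub_C_mul_divByMonic hy]
  rw [leadingCoeff_mul, leadingCoeff_X_sub_C, one_mul]

lemma sum_weights {q : ℝ} {F : ℝ[X]} (hF : F ≠ 0) (hs : F.roots.card = F.natDegree) {w : ℝ → ℝ}
    (h : dq q F = ∑ y ∈ F.roots.toFinset, C (w y) * (F /ₘ (X - C y))) :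
    ∑ y ∈ F.roots.toFinset, w y = qNum q⁻¹ F.natDegree := by
  rcases hd : F.natDegree with _ | d
  · rw [hd] at hs
    rw [Multiset.card_eq_zero.1 hs]; simp [qNum_zero]
  · have h1 := congrArg (fun P => P.coeff d) h
    simp only [coeff_dq, finsetSum_coeff, coeff_C_mul] at h1
    have h2 : ∀ y ∈ F.roots.toFinset, w y * (F /ₘ (X - C y)).coeff d = w y * F.leadingCoeff := by
      intro y hy
      rw [Multiset.mem_toFinset] at hy
      rw [← leadingCoeff_divByMonic_X_sub_C hy, leadingCoeff, natDegree_divByMonic_X_sub_C, hd]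
      rfl
    have h3 : F.coeff (d + 1) = F.leadingCoeff := by rw [leadingCoeff, hd]
    have h4 : F.leadingCoeff ≠ 0 := by simpa
    rw [Finset.sum_congr rfl h2, ← Finset.sum_mul, h3, mul_comm] at h1
    exact (mul_right_cancel₀ h4 h1).symm

lemma bez_X_sub_C_mul_mul {z : ℂ} (hz : z.im ≠ 0) (s : ℝ) (Q D : ℝ[X]) :
    bez z ((X - C s) * Q) ((X - C s) * D) = Complex.normSq (z - s) * bez z Q D := by
  unfold bez
  rw [if_neg hz, if_neg hz]
  simp [Complex.mul_im, Complex.normSq_apply]; ring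

lemma InCone.X_sub_C_mul {D D' P : ℝ[X]} {s : ℝ} (hD : D = (X - C s) * D') (hD0 : D ≠ 0)
    (h : InCone D' P) : InCone D ((X - C s) * P) := by
  obtain ⟨w, hw, rfl⟩ := h
  rw [Finset.mul_sum]
  refine InCone.sum _ _ fun y hy => ?_
  rw [Multiset.mem_toFinset] at hy
  have hy' : y ∈ D.roots := by
    rw [hD, roots_mul (hD ▸ hD0)]; exact Multiset.mem_add.2 (Or.inr hy)
  have h1 : D /ₘ (X - C y) = (X - C s) * (D' /ₘ (X - C y)) := by
    apply divByMonic_eq_of_eq_mul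
    rw [hD]
    conv_lhs => rw [← X_sub_C_mul_divByMonic hy]
    ring
  rw [show (X - C s) * (C (w y) * (D' /ₘ (X - C y)))
    = C (w y) * ((X - C s) * (D' /ₘ (X - C y))) by ring, ← h1]
  exact (InCone.divByMonic hy').C_mul (hw y)

/-- The local sign condition imposed by the Bezoutian at a zero of the denominator. -/
lemma local_sign {Q D D₂ : ℝ[X]} {s : ℝ} {k : ℕ} (hD : D = (X - C s) ^ k * D₂)
    (h : ∀ z : ℂ, z.im ≠ 0 → bez z Q D ≤ 0) {u : ℂ} (hu : 0 < u.im) :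
    0 ≤ (u ^ k).im * (Q.eval s * D₂.eval s) := by
  let f : ℝ → ℝ := fun ε =>
    (aeval ((s : ℂ) + ε * u) Q * (starRingEnd ℂ) (u ^ k * aeval ((s : ℂ) + ε * u) D₂)).im
  have hf : Continuous f := by
    have h1 : ∀ P : ℝ[X], Continuous fun ε : ℝ => aeval ((s : ℂ) + ε * u) P := by
      intro P
      exact (Polynomial.continuous_aeval P).comp (by fun_prop)
    exact Complex.continuous_im.comp ((h1 Q).mul (Complex.continuous_conj.comp
      (continuous_const.mul (h1 D₂))))
  have hle : ∀ ε : ℝ, 0 < ε → f ε ≤ 0 := by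
    intro ε hε
    have him : ((s : ℂ) + ε * u).im = ε * u.im := by simp [Complex.mul_im]
    have hpos : 0 < ((s : ℂ) + ε * u).im := by rw [him]; positivity
    have := h _ hpos.ne'
    rw [bez, if_neg hpos.ne', div_le_iff₀ hpos, zero_mul, hD] at this
    have h2 : aeval ((s : ℂ) + ε * u) ((X - C s) ^ k * D₂)
        = ((ε ^ k : ℝ) : ℂ) * (u ^ k * aeval ((s : ℂ) + ε * u) D₂) := by
      simp [mul_pow]; ring
    rw [h2, map_mul, Complex.conj_ofReal, mul_left_comm, Complex.im_ofReal_mul] at this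
    exact nonpos_of_mul_nonpos_right this (by positivity)
  have h0 : f 0 ≤ 0 := by
    have h1 : Tendsto f (nhdsWithin 0 (Set.Ioi 0)) (nhds (f 0)) :=
      hf.continuousAt.tendsto.mono_left nhdsWithin_le_nhds
    exact le_of_tendsto h1 (by filter_upwards [self_mem_nhdsWithin] with ε hε using hle ε hε)
  have h3 : f 0 = - ((u ^ k).im * (Q.eval s * D₂.eval s)) := by
    have h4 : ∀ P : ℝ[X], aeval (s : ℂ) P = ((P.eval s : ℝ) : ℂ) := by
      intro P
      have := aeval_ofReal_re (z := (s : ℂ)) (by simp) P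
      simpa using this
    simp only [f, Complex.ofReal_zero, zero_mul, add_zero, h4]
    rw [map_mul, Complex.conj_ofReal, Complex.im_ofReal_mul, Complex.im_mul_ofReal, Complex.conj_im]
    ring
  linarith

lemma exists_pow_eq_I {k : ℕ} (hk : 1 ≤ k) : ∃ u : ℂ, 0 < u.im ∧ u ^ k = Complex.I := by
  have hk' : (1 : ℝ) ≤ k := by exact_mod_cast hk
  have hk0 : (k : ℂ) ≠ 0 := by exact_mod_cast (show k ≠ 0 by omega)
  refine ⟨Complex.exp ((Real.pi / (2 * k) : ℝ) * Complex.I), ?_, ?_⟩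
  · rw [Complex.exp_ofReal_mul_I_im]
    apply Real.sin_pos_of_pos_of_lt_pi
    · positivity
    · rw [div_lt_iff₀ (by positivity)]; nlinarith [Real.pi_pos]
  · rw [← Complex.exp_nat_mul, show (k : ℂ) * (((Real.pi / (2 * k) : ℝ) : ℂ) * Complex.I)
      = Real.pi / 2 * Complex.I by push_cast; field_simp]
    exact Complex.exp_pi_div_two_mul_I

lemma exists_pow_eq_neg_I {k : ℕ} (hk : 2 ≤ k) : ∃ u : ℂ, 0 < u.im ∧ u ^ k = -Complex.I := by
  have hk' : (2 : ℝ) ≤ k := by exact_mod_cast hk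
  have hk0 : (k : ℂ) ≠ 0 := by exact_mod_cast (show k ≠ 0 by omega)
  refine ⟨Complex.exp ((3 * Real.pi / (2 * k) : ℝ) * Complex.I), ?_, ?_⟩
  · rw [Complex.exp_ofReal_mul_I_im]
    apply Real.sin_pos_of_pos_of_lt_pi
    · positivity
    · rw [div_lt_iff₀ (by positivity)]; nlinarith [Real.pi_pos]
  · rw [← Complex.exp_nat_mul, show (k : ℂ) * (((3 * Real.pi / (2 * k) : ℝ) : ℂ) * Complex.I)
      = Real.pi * Complex.I + Real.pi / 2 * Complex.I by push_cast; field_simp; ring,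
      Complex.exp_add, Complex.exp_pi_div_two_mul_I, Complex.exp_pi_mul_I]
    ring

lemma partial_fractions_of_coprime {Q D : ℝ[X]} (hD : D ≠ 0) (hs : D.roots.card = D.natDegree)
    (hdeg : Q.natDegree ≤ D.natDegree + 1) (h : ∀ z : ℂ, z.im ≠ 0 → bez z Q D ≤ 0)
    (hcop : ∀ s ∈ D.roots, Q.eval s ≠ 0) : ∃ (e c : ℝ) (P : ℝ[X]), InCone D P ∧ Q = (C e * X + C c) * D + P := by
  have hloc : ∀ s ∈ D.roots, (D /ₘ (X - C s)).eval s ≠ 0 ∧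
      0 ≤ Q.eval s / (D /ₘ (X - C s)).eval s := by
    intro s hs'
    obtain ⟨D₂, hD₂, hnd⟩ := exists_eq_pow_rootMultiplicity_mul_and_not_dvd D hD s
    have hμ : 1 ≤ D.rootMultiplicity s := (rootMultiplicity_pos hD).2 (isRoot_of_mem_roots hs')
    rw [dvd_iff_isRoot, IsRoot.def] at hnd
    have hne : Q.eval s * D₂.eval s ≠ 0 := mul_ne_zero (hcop s hs') hnd
    obtain ⟨u, hu, huk⟩ := exists_pow_eq_I hμ
    have h1 := local_sign hD₂ h hu
    rw [huk, Complex.I_im, one_mul] at h1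
    have hμ1 : D.rootMultiplicity s = 1 := by
      by_contra hμ2
      obtain ⟨v, hv, hvk⟩ := exists_pow_eq_neg_I (show 2 ≤ D.rootMultiplicity s by omega)
      have h2 := local_sign hD₂ h hv
      rw [hvk, Complex.neg_im, Complex.I_im] at h2
      exact hne (by linarith)
    rw [hμ1, pow_one] at hD₂
    rw [divByMonic_eq_of_eq_mul hD₂]
    refine ⟨hnd, ?_⟩
    have : Q.eval s / D₂.eval s = Q.eval s * D₂.eval s / (D₂.eval s) ^ 2 := by
      field_simp
    rw [this]; positivity
  have hnodup : D.roots.Nodup := by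
    rw [Multiset.nodup_iff_count_le_one]
    intro s
    by_contra hc
    have hs' : s ∈ D.roots := Multiset.count_pos.1 (by omega)
    refine (hloc s hs').1 ?_
    rw [← IsRoot.def, ← mem_roots (divByMonic_ne_zero hs')]
    rw [roots_divByMonic hs', Multiset.count_cons_self] at hc
    exact Multiset.count_pos.1 (by omega)
  let w : ℝ → ℝ := fun s => if s ∈ D.roots then Q.eval s / (D /ₘ (X - C s)).eval s else 0
  let P : ℝ[X] := ∑ y ∈ D.roots.toFinset, C (w y) * (D /ₘ (X - C y))
  have hP : InCone D P := ⟨w, fun y => by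
    by_cases hy : y ∈ D.roots
    · simp only [w, if_pos hy]; exact (hloc y hy).2
    · exact (if_neg hy).ge, rfl⟩
  have heval : ∀ s ∈ D.roots, (Q - P).eval s = 0 := by
    intro s hs'
    rw [eval_sub, eval_finsetSum, Finset.sum_eq_single s]
    · simp only [w, if_pos hs', eval_mul, eval_C]
      rw [div_mul_cancel₀ _ (hloc s hs').1, sub_self]
    · intro y hy hys
      rw [Multiset.mem_toFinset] at hy
      have h1 : D.eval s = 0 := isRoot_of_mem_roots hs'
      rw [← X_sub_C_mul_divByMonic hy, eval_mul] at h1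
      have h2 : (X - C y).eval s ≠ 0 := by simpa [sub_eq_zero] using Ne.symm hys
      rw [eval_mul, (mul_eq_zero.1 h1).resolve_left h2, mul_zero]
    · intro hn; exact absurd (Multiset.mem_toFinset.2 hs') hn
  have hPdeg : P.natDegree ≤ D.natDegree := by
    apply natDegree_sum_le_of_forall_le
    intro y _
    refine (natDegree_C_mul_le _ _).trans ?_
    rw [natDegree_divByMonic_X_sub_C]; omega
  have hdvd : D ∣ Q - P := by
    by_cases hR : Q - P = 0
    · rw [hR]; exact dvd_zero _
    · have hle : D.roots ≤ (Q - P).roots :=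
        (Multiset.le_iff_subset hnodup).2 fun s hs' => (mem_roots hR).2 (heval s hs')
      rw [← Multiset.prod_X_sub_C_dvd_iff_le_roots hR] at hle
      rw [← C_leadingCoeff_mul_prod_multiset_X_sub_C hs]
      exact (IsUnit.mul_left_dvd (isUnit_C.2 (by simpa using hD))).2 hle
  obtain ⟨R, hR⟩ := hdvd
  have hRdeg : R.natDegree ≤ 1 := by
    by_cases hR0 : R = 0
    · simp [hR0]
    · have h1 : (Q - P).natDegree ≤ D.natDegree + 1 :=
        (natDegree_sub_le _ _).trans (max_le hdeg (by omega))
      rw [hR, natDegree_mul hD hR0] at h1; omega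
  refine ⟨R.coeff 1, R.coeff 0, P, hP, ?_⟩
  rw [← eq_X_add_C_of_natDegree_le_one hRdeg, mul_comm, ← hR]; ring

lemma exists_eq_mul_add_inCone {Q D : ℝ[X]} (hD : D ≠ 0) (hs : D.roots.card = D.natDegree)
    (hdeg : Q.natDegree ≤ D.natDegree + 1) (h : ∀ z : ℂ, z.im ≠ 0 → bez z Q D ≤ 0) :
    ∃ (e c : ℝ) (P : ℝ[X]), InCone D P ∧ Q = (C e * X + C c) * D + P := by
  induction hn : D.natDegree using Nat.strong_induction_on generalizing D Q with
  | _ n ih =>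
    by_cases hcop : ∀ s ∈ D.roots, Q.eval s ≠ 0
    · exact partial_fractions_of_coprime hD hs hdeg h hcop
    push Not at hcop
    obtain ⟨s, hs', hQ⟩ := hcop
    obtain ⟨D', hD'⟩ : ∃ D', D' = D /ₘ (X - C s) := ⟨_, rfl⟩
    obtain ⟨Q', hQ'⟩ : ∃ Q', Q' = Q /ₘ (X - C s) := ⟨_, rfl⟩
    have hDD : D = (X - C s) * D' := by rw [hD', X_sub_C_mul_divByMonic hs']
    have hQQ : Q = (X - C s) * Q' := by
      rw [hQ']; exact (mul_divByMonic_eq_iff_isRoot.2 hQ).symm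
    have hpos : 0 < D.natDegree := by
      rw [← hs]; exact Multiset.card_pos_iff_exists_mem.2 ⟨s, hs'⟩
    have hD'deg : D'.natDegree = D.natDegree - 1 := by rw [hD', natDegree_divByMonic_X_sub_C]
    obtain ⟨e, c, P, hP, hQP⟩ := ih (D'.natDegree) (by omega) (Q := Q') (D := D')
      (right_ne_zero_of_mul (hDD ▸ hD)) (by rw [hD']; exact card_roots_divByMonic hs' hs)
      (by rw [hD', hQ', natDegree_divByMonic_X_sub_C, natDegree_divByMonic_X_sub_C]; omega)
      (fun z hz => by
        have h1 := h z hz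
        rw [hDD, hQQ, bez_X_sub_C_mul_mul hz] at h1
        refine nonpos_of_mul_nonpos_right h1 (Complex.normSq_pos.2 fun h0 => hz ?_)
        have := congrArg Complex.im h0
        simpa using this) rfl
    refine ⟨e, c, (X - C s) * P, hP.X_sub_C_mul hDD hD, ?_⟩
    rw [hQQ, hQP, hDD]; ring

lemma InCone.coeff_eq_zero {D P : ℝ[X]} (h : InCone D P) {k : ℕ} (hk : D.natDegree ≤ k) :
    P.coeff k = 0 := by
  obtain ⟨w, hw, rfl⟩ := h
  rw [finsetSum_coeff]
  refine Finset.sum_eq_zero fun y hy => ?_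
  rw [Multiset.mem_toFinset] at hy
  have hpos : 0 < D.natDegree := by
    by_contra h0
    rw [eq_C_of_natDegree_eq_zero (show D.natDegree = 0 by omega)] at hy
    simp at hy
  rw [coeff_C_mul, coeff_eq_zero_of_natDegree_lt, mul_zero]
  rw [natDegree_divByMonic_X_sub_C]; omega

/-- Partial fractions of a rational function mapping the upper half-plane into the lower one. -/
lemma partial_fractions {Q D : ℝ[X]} (hD : D ≠ 0) (hs : D.roots.card = D.natDegree)
    (hdeg : Q.natDegree ≤ D.natDegree + 1) (h : ∀ z : ℂ, bez z Q D ≤ 0) :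
    ∃ (e c : ℝ) (w : ℝ → ℝ), e ≤ 0 ∧ (∀ y, 0 ≤ w y) ∧
      Q.coeff (D.natDegree + 1) = e * D.leadingCoeff ∧
      (e = 0 → Q.coeff D.natDegree = c * D.leadingCoeff) ∧
      Q = (C e * X + C c) * D + ∑ s ∈ D.roots.toFinset, C (w s) * (D /ₘ (X - C s)) := by
  obtain ⟨e, c, P, hP, hQ⟩ := exists_eq_mul_add_inCone hD hs hdeg fun z _ => h z
  have hPc := hP
  obtain ⟨w, hw, hPw⟩ := hP
  refine ⟨e, c, w, ?_, hw, ?_, ?_, by rw [hQ, hPw]⟩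
  · have hle : ∀ᶠ x : ℝ in atTop, e ≤ ∑ s ∈ D.roots.toFinset, w s / (x - s) ^ 2 := by
      filter_upwards [eventually_atTop_not_isRoot D hD] with x hx
      have hx' : D.eval x ≠ 0 := hx
      have hval : bez x Q D = e * (D.eval x) ^ 2
          - (∑ s ∈ D.roots.toFinset, w s / (x - s) ^ 2) * (D.eval x) ^ 2 := by
        rw [hQ, hPw, bez_add_left, add_mul, bez_add_left, mul_assoc, bez_C_mul_left, bez_C_mul_left,
          bez_self, bez_antisymm, bez_self_X_mul, bez_sum_left, Finset.sum_mul, sub_eq_add_neg,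
          ← Finset.sum_neg_distrib]
        have hsq : ∀ A : ℝ[X], sqAbs (x : ℂ) A = (A.eval x) ^ 2 := by
          intro A
          rw [sqAbs, aeval_ofReal_re (by simp)]
          simp [sq]
        congr 1
        · rw [hsq]; ring
        · refine Finset.sum_congr rfl fun y hy => ?_
          rw [Multiset.mem_toFinset] at hy
          rw [bez_C_mul_left, bez_divByMonic hy, hsq]
          have h1 := congrArg (eval x) (X_sub_C_mul_divByMonic hy)
          rw [eval_mul, eval_sub, eval_X, eval_C] at h1
          have h2 : x - y ≠ 0 := fun h2 => hx' (by rw [← h1, h2, zero_mul])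
          rw [← h1]; field_simp
      have := h x
      rw [hval] at this
      have hpos : 0 < (D.eval x) ^ 2 := by positivity
      nlinarith
    have hlim : Tendsto (fun x : ℝ => ∑ s ∈ D.roots.toFinset, w s / (x - s) ^ 2) atTop (nhds 0) := by
      rw [show (0 : ℝ) = ∑ s ∈ D.roots.toFinset, 0 by simp]
      refine tendsto_finsetSum _ fun s _ => Tendsto.div_atTop tendsto_const_nhds ?_
      exact (tendsto_pow_atTop two_ne_zero).comp (tendsto_atTop_add_const_right _ (-s) tendsto_id)
    exact ge_of_tendsto hlim hle
  · rw [hQ, coeff_add, hPc.coeff_eq_zero (by omega), add_mul, coeff_add, mul_assoc, coeff_C_mul,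
      coeff_X_mul, coeff_C_mul, coeff_eq_zero_of_natDegree_lt (n := D.natDegree + 1) (by omega)]
    simp
  · rintro rfl
    rw [hQ, coeff_add, hPc.coeff_eq_zero le_rfl]
    simp

lemma two_le_count_roots {P : ℝ[X]} (hP : P ≠ 0) {s : ℝ} :
    2 ≤ P.roots.count s ↔ P.eval s = 0 ∧ (derivative P).eval s = 0 := by
  rw [count_roots]
  exact one_lt_rootMultiplicity_iff_isRoot hP

lemma logSep_roots_iff {q : ℝ} {P : ℝ[X]} (hP : P ≠ 0) : LogSep q P.roots ↔
    (∀ s, s ≠ 0 → P.eval s = 0 → (derivative P).eval s = 0 → 1 ≤ q) ∧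
    (∀ s t, 0 < s → s < t → P.eval s = 0 → P.eval t = 0 → s ≤ q * t) ∧
    (∀ s t, 0 < s → s < t → (P.comp (-X)).eval s = 0 → (P.comp (-X)).eval t = 0 → s ≤ q * t) := by
  simp only [LogSep, mem_roots hP, IsRoot.def, two_le_count_roots hP, eval_comp, eval_neg, eval_X]
  constructor
  · rintro ⟨h1, h2⟩
    refine ⟨fun s hs h h' => h1 s h hs ⟨h, h'⟩, fun s t hs hst h h' => ?_, fun s t hs hst h h' => ?_⟩
    · have := h2 s h t h' (Or.inr ⟨hs, hst⟩)
      rwa [div_le_iff₀ (by linarith)] at this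
    · have := h2 _ h _ h' (Or.inl ⟨by linarith, by linarith⟩)
      rwa [neg_div_neg_eq, div_le_iff₀ (by linarith)] at this
  · rintro ⟨h1, h2, h3⟩
    refine ⟨fun s h hs h' => h1 s hs h h'.2, fun x hx y hy => ?_⟩
    rintro (⟨h, h'⟩ | ⟨h, h'⟩)
    · have := h3 (-x) (-y) (by linarith) (by linarith) (by simpa) (by simpa)
      rw [div_le_iff_of_neg (by linarith)]; linarith
    · rw [div_le_iff₀ (by linarith)]; exact h2 x y h h' hx hy

lemma strictLogSep_roots_iff {q : ℝ} {P : ℝ[X]} (hP : P ≠ 0) : StrictLogSep q P.roots ↔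
    (∀ s, s ≠ 0 → P.eval s = 0 → (derivative P).eval s = 0 → 1 < q) ∧
    (∀ s t, 0 < s → s < t → P.eval s = 0 → P.eval t = 0 → s < q * t) ∧
    (∀ s t, 0 < s → s < t → (P.comp (-X)).eval s = 0 → (P.comp (-X)).eval t = 0 → s < q * t) := by
  simp only [StrictLogSep, mem_roots hP, IsRoot.def, two_le_count_roots hP, eval_comp, eval_neg,
    eval_X]
  constructor
  · rintro ⟨h1, h2⟩
    refine ⟨fun s hs h h' => h1 s h hs ⟨h, h'⟩, fun s t hs hst h h' => ?_, fun s t hs hst h h' => ?_⟩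
    · have := h2 s h t h' (Or.inr ⟨hs, hst⟩)
      rwa [div_lt_iff₀ (by linarith)] at this
    · have := h2 _ h _ h' (Or.inl ⟨by linarith, by linarith⟩)
      rwa [neg_div_neg_eq, div_lt_iff₀ (by linarith)] at this
  · rintro ⟨h1, h2, h3⟩
    refine ⟨fun s h hs h' => h1 s hs h h'.2, fun x hx y hy => ?_⟩
    rintro (⟨h, h'⟩ | ⟨h, h'⟩)
    · have := h3 (-x) (-y) (by linarith) (by linarith) (by simpa) (by simpa)
      rw [div_lt_iff_of_neg (by linarith)]; linarith
    · rw [div_lt_iff₀ (by linarith)]; exact h2 x y h h' hx hy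

lemma logSep_one (s : Multiset ℝ) : LogSep 1 s := by
  refine ⟨fun _ _ _ _ => le_rfl, fun x _ y _ h => ?_⟩
  rcases h with ⟨h, h'⟩ | ⟨h, h'⟩
  · rw [div_le_iff_of_neg (by linarith)]; linarith
  · rw [div_le_iff₀ (by linarith)]; linarith

lemma eval_mul_eval_pos {K : ℝ[X]} {a b : ℝ} (hab : a ≤ b)
    (h : ∀ x, a ≤ x → x ≤ b → K.eval x ≠ 0) : 0 < K.eval a * K.eval b := by
  by_contra hc
  push Not at hc
  have hmem : (0 : ℝ) ∈ Set.uIcc (K.eval a) (K.eval b) := by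
    rw [Set.mem_uIcc]
    rcases mul_nonpos_iff.1 hc with ⟨h1, h2⟩ | ⟨h1, h2⟩
    · exact Or.inr ⟨h2, h1⟩
    · exact Or.inl ⟨h1, h2⟩
  obtain ⟨x, hx, h0⟩ := intermediate_value_uIcc (f := fun x => K.eval x)
    K.continuous.continuousOn hmem
  rw [Set.uIcc_of_le hab] at hx
  exact h x hx.1 hx.2 h0

/-- Between two zeros of `E` there is a zero of `G` or a zero of their Wronskian. -/
lemma exists_bez_eq_zero {E G : ℝ[X]} {a b : ℝ} (hab : a < b) (hEa : E.eval a = 0)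
    (hEb : E.eval b = 0) (hG : ∀ x, a ≤ x → x ≤ b → G.eval x ≠ 0) :
    ∃ x : ℝ, a < x ∧ x < b ∧ bez x E G = 0 := by
  obtain ⟨x, hx, h⟩ := exists_deriv_eq_zero (f := fun x => E.eval x / G.eval x) hab
    (E.continuous.continuousOn.div G.continuous.continuousOn fun x hx => hG x hx.1 hx.2)
    (by simp [hEa, hEb])
  have hGx := hG x hx.1.le hx.2.le
  have h1 := ((E.hasDerivAt x).div (G.hasDerivAt x) hGx).deriv
  refine ⟨x, hx.1, hx.2, ?_⟩
  have h2 : deriv (fun x => E.eval x / G.eval x) x = _ := h1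
  rw [h, eq_comm, div_eq_zero_iff] at h2
  rw [bez_ofReal]
  exact h2.resolve_right (pow_ne_zero 2 hGx)

/-- The combination `G(z) - l * G(z / q)`. -/
noncomputable def dilDiff (q l : ℝ) (G : ℝ[X]) : ℝ[X] := G - C l * G.comp (C q⁻¹ * X)

lemma eval_dilDiff (q l : ℝ) (G : ℝ[X]) (s : ℝ) :
    (dilDiff q l G).eval s = G.eval s - l * G.eval (s / q) := by
  simp [dilDiff, div_eq_inv_mul]

lemma derivative_dilDiff (q l : ℝ) (G : ℝ[X]) (s : ℝ) : (derivative (dilDiff q l G)).eval s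
    = (derivative G).eval s - l / q * (derivative G).eval (s / q) := by
  simp [dilDiff, div_eq_inv_mul, derivative_comp]; ring

lemma dilDiff_comp_neg (q l : ℝ) (G : ℝ[X]) :
    dilDiff q l (G.comp (-X)) = (dilDiff q l G).comp (-X) := by
  simp [dilDiff, comp_assoc]

section sep

variable {q l : ℝ} {G : ℝ[X]}

lemma dilDiff_ne_zero_of_between (hq : 0 < q) (hq1 : q < 1) (hl : 0 < l) (hG : G ≠ 0)
    (hsep : LogSep q G.roots) {y s : ℝ} (hy : 0 < y) (hGy : G.eval y = 0) (h1 : q * y < s)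
    (h2 : s < y) : G.eval s ≠ l * G.eval (s / q) := by
  rw [logSep_roots_iff hG] at hsep
  obtain ⟨K, hK⟩ := dvd_iff_isRoot.2 (show G.IsRoot y from hGy)
  have hs : 0 < s := lt_trans (by positivity) h1
  have hys : y < s / q := by rw [lt_div_iff₀ hq]; linarith
  have hK0 : ∀ x, s ≤ x → x ≤ s / q → K.eval x ≠ 0 := by
    intro x hx1 hx2 h0
    have hGx : G.eval x = 0 := by rw [hK]; simp [h0]
    rcases lt_trichotomy x y with h | h | h
    · have := hsep.2.1 x y (by linarith) h hGx hGy; linarith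
    · subst h
      have := hsep.1 x hy.ne' hGx (by rw [hK]; simp [h0])
      linarith
    · have := hsep.2.1 y x hy h hGy hGx
      rw [le_div_iff₀ hq] at hx2; linarith
  have hpos := eval_mul_eval_pos (by linarith) hK0
  have hne := hK0 (s / q) (by linarith) le_rfl
  intro heq
  have e1 : G.eval s = (s - y) * K.eval s := by rw [hK]; simp
  have e2 : G.eval (s / q) = (s / q - y) * K.eval (s / q) := by rw [hK]; simp
  rw [e1, e2] at heq
  have h3 : (s - y) * (K.eval s * K.eval (s / q)) = l * (s / q - y) * (K.eval (s / q)) ^ 2 := by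
    linear_combination K.eval (s / q) * heq
  have h4 : (s - y) * (K.eval s * K.eval (s / q)) < 0 := mul_neg_of_neg_of_pos (by linarith) hpos
  have h5 : 0 < l * (s / q - y) * (K.eval (s / q)) ^ 2 := by
    have : 0 < s / q - y := by linarith
    positivity
  linarith

lemma pos_separated (hq : 0 < q) (hq1 : q < 1) (hl : 0 < l) (hG : G ≠ 0)
    (hsep : LogSep q G.roots) {H E : ℝ[X]} (hHE : H ∣ E) (hHD : H ∣ dilDiff q l G)
    (hbez : ∀ x : ℝ, x ≠ 0 → G.eval x ≠ 0 → bez x E G ≠ 0) {s t : ℝ} (hs : 0 < s) (hst : s < t)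
    (hHs : H.eval s = 0) (hHt : H.eval t = 0) :
    s ≤ q * t ∧ (StrictLogSep q G.roots → s < q * t) := by
  have hE : ∀ x, H.eval x = 0 → E.eval x = 0 := fun x hx => eval_eq_zero_of_dvd_of_eval_eq_zero hHE hx
  have hD : ∀ x, H.eval x = 0 → G.eval x = l * G.eval (x / q) := fun x hx => by
    have := eval_eq_zero_of_dvd_of_eval_eq_zero hHD hx
    rw [eval_dilDiff] at this; linarith
  have hsq : q * (s / q) = s := by field_simp
  by_cases hGs : G.eval s = 0
  · have hGsq : G.eval (s / q) = 0 := by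
      have := hD s hHs
      rw [hGs, eq_comm, mul_eq_zero] at this
      exact this.resolve_left hl.ne'
    have hssq : s < s / q := by rw [lt_div_iff₀ hq]; nlinarith
    constructor
    · by_contra hc
      push Not at hc
      refine dilDiff_ne_zero_of_between hq hq1 hl hG hsep (y := s / q) (by positivity) hGsq
        (s := t) (by linarith) ?_ (hD t hHt)
      rw [lt_div_iff₀ hq]; linarith
    · intro hstr
      have := ((strictLogSep_roots_iff hG).1 hstr).2.1 s (s / q) hs hssq hGs hGsq
      linarith
  · have hex : ∃ y, s ≤ y ∧ y ≤ t ∧ G.eval y = 0 := by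
      by_contra hc
      push Not at hc
      obtain ⟨x, hx1, _, hx⟩ := exists_bez_eq_zero hst (hE s hHs) (hE t hHt) hc
      exact hbez x (by linarith) (hc x hx1.le (by linarith)) hx
    obtain ⟨y, hy1, hy2, hGy⟩ := hex
    have hsy : s < y := lt_of_le_of_ne hy1 (by rintro rfl; exact hGs hGy)
    have hle : s ≤ q * y := by
      by_contra hc
      push Not at hc
      exact dilDiff_ne_zero_of_between hq hq1 hl hG hsep (by linarith) hGy hc hsy (hD s hHs)
    have hlt : s < q * t := by
      refine lt_of_le_of_ne (by nlinarith) fun heq => ?_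
      have : y = t := by
        apply le_antisymm hy2
        by_contra hc; push Not at hc; nlinarith
      subst this
      apply hGs
      rw [hD s hHs, show s / q = y by rw [heq]; field_simp, hGy, mul_zero]
    exact ⟨hlt.le, fun _ => hlt⟩

lemma dq_eval_ne_zero (hq : 0 < q) (hq1 : q ≤ 1) (hG : G ≠ 0)
    (hsep : StrictLogSep q G.roots) {s : ℝ} (hs : s ≠ 0) (h : G.eval s = 0) :
    (dq q G).eval s ≠ 0 := by
  rw [strictLogSep_roots_iff hG] at hsep
  intro h0
  rcases hq1.eq_or_lt with rfl | hq1
  · rw [dq_one] at h0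
    exact absurd (hsep.1 s hs h h0) (lt_irrefl _)
  · have h1 : G.eval (s / q) = 0 := by
      have := congrArg (eval s) (comp_inv_mul hq G)
      simp [h0, h] at this
      rwa [div_eq_inv_mul]
    rcases lt_or_gt_of_ne hs with hs | hs
    · have := hsep.2.2 (-s) (-(s / q)) (by linarith)
        (by rw [neg_lt_neg_iff, div_lt_iff₀ hq]; nlinarith) (by simpa) (by simpa)
      have h2 : q * (s / q) = s := by field_simp
      linarith
    · have := hsep.2.1 s (s / q) hs (by rw [lt_div_iff₀ hq]; nlinarith) h h1
      have h2 : q * (s / q) = s := by field_simp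
      linarith

/-- A common zero `s > 0` of `G` and `dilDiff q l G` is a simple zero of the latter. -/
lemma derivative_dilDiff_ne_zero (hq : 0 < q) (hq1 : q < 1) (hl : 0 < l) (hG : G ≠ 0)
    (hsep : LogSep q G.roots) {s : ℝ} (hs : 0 < s) (hGs : G.eval s = 0)
    (hD : (dilDiff q l G).eval s = 0) : (derivative (dilDiff q l G)).eval s ≠ 0 := by
  rw [logSep_roots_iff hG] at hsep
  obtain ⟨t, ht⟩ : ∃ t, t = s / q := ⟨_, rfl⟩
  have hst : s < t := by rw [ht, lt_div_iff₀ hq]; nlinarith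
  have hqt : q * t = s := by rw [ht]; field_simp
  have hGt : G.eval t = 0 := by
    rw [eval_dilDiff, hGs, ← ht, zero_sub, neg_eq_zero, mul_eq_zero] at hD
    exact hD.resolve_left hl.ne'
  obtain ⟨K, hK⟩ := dvd_iff_isRoot.2 (show G.IsRoot s from hGs)
  have hKt : K.IsRoot t := by
    rw [hK, eval_mul, mul_eq_zero] at hGt
    exact hGt.resolve_left (by simp [sub_eq_zero, hst.ne'])
  obtain ⟨M, hM⟩ := dvd_iff_isRoot.2 hKt
  have hGM : G = (X - C s) * ((X - C t) * M) := by rw [hK, hM]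
  have hd : derivative G = (X - C t) * M + (X - C s) * M
      + (X - C s) * ((X - C t) * derivative M) := by
    rw [hGM]; simp; ring
  have hM0 : ∀ x, s ≤ x → x ≤ t → M.eval x ≠ 0 := by
    intro x hx1 hx2 h0
    have hGx : G.eval x = 0 := by rw [hGM]; simp [h0]
    by_cases hxs : x = s
    · subst hxs
      have := hsep.1 x hs.ne' hGs (by rw [hd]; simp [h0]); linarith
    by_cases hxt : x = t
    · subst hxt
      have := hsep.1 x (by linarith) hGx (by rw [hd]; simp [h0]); linarith
    have h1 := hsep.2.1 x t (by linarith) (lt_of_le_of_ne hx2 hxt) hGx (by rw [hGM]; simp)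
    exact hxs (by linarith)
  have hpos := eval_mul_eval_pos hst.le hM0
  have hne := hM0 t hst.le le_rfl
  rw [derivative_dilDiff, ← ht, hd]
  simp only [eval_add, eval_mul, eval_sub, eval_X, eval_C, sub_self, zero_mul, add_zero, zero_add]
  intro h0
  have h1 : M.eval s + l / q * M.eval t = 0 := by
    have : (s - t) * (M.eval s + l / q * M.eval t) = 0 := by linear_combination h0
    exact (mul_eq_zero.1 this).resolve_left (by linarith)
  have h2 : M.eval s * M.eval t = - (l / q * (M.eval t) ^ 2) := by
    linear_combination (M.eval t) * h1
  have : 0 < l / q * (M.eval t) ^ 2 := by positivity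
  linarith

lemma bez_comp_neg (x : ℝ) (B A : ℝ[X]) :
    bez x (B.comp (-X)) (A.comp (-X)) = - bez ((-x : ℝ) : ℂ) B A := by
  rw [bez_ofReal, bez_ofReal]; simp [derivative_comp]; ring

lemma logSep_roots_comp_neg {s : Multiset ℝ} (h : LogSep q s) :
    LogSep q (s.map fun x => -x) := by
  simp only [LogSep, Multiset.mem_map, forall_exists_index, and_imp, forall_apply_eq_imp_iff₂]
  refine ⟨fun x hx hx0 h2 => ?_, fun x hx y hy h' => ?_⟩
  · rw [Multiset.count_map_eq_count' _ _ neg_injective] at h2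
    exact h.1 x hx (by simpa using hx0) h2
  · rw [neg_div_neg_eq]
    apply h.2 x hx y hy
    rcases h' with h' | h'
    · exact Or.inr ⟨by linarith, by linarith⟩
    · exact Or.inl ⟨by linarith, by linarith⟩

lemma strictLogSep_roots_comp_neg {s : Multiset ℝ} (h : StrictLogSep q s) :
    StrictLogSep q (s.map fun x => -x) := by
  simp only [StrictLogSep, Multiset.mem_map, forall_exists_index, and_imp,
    forall_apply_eq_imp_iff₂]
  refine ⟨fun x hx hx0 h2 => ?_, fun x hx y hy h' => ?_⟩
  · rw [Multiset.count_map_eq_count' _ _ neg_injective] at h2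
    exact h.1 x hx (by simpa using hx0) h2
  · rw [neg_div_neg_eq]
    apply h.2 x hx y hy
    rcases h' with h' | h'
    · exact Or.inr ⟨by linarith, by linarith⟩
    · exact Or.inl ⟨by linarith, by linarith⟩

/-- Zeros of a divisor of a dilation difference inherit logarithmic separation. -/
lemma logSep_of_dvd_dilDiff (hq : 0 < q) (hq1 : q < 1) (hl : 0 < l) (hG : G ≠ 0)
    (hsep : LogSep q G.roots) {H E : ℝ[X]} (hH : H ≠ 0) (hHE : H ∣ E) (hHD : H ∣ dilDiff q l G)
    (hbez : ∀ x : ℝ, x ≠ 0 → G.eval x ≠ 0 → bez x E G ≠ 0) :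
    LogSep q H.roots ∧ (StrictLogSep q G.roots → StrictLogSep q H.roots) := by
  have hGn : G.comp (-X) ≠ 0 := fun h => hG (comp_neg_X_eq_zero_iff.1 h)
  have hsepn : LogSep q (G.comp (-X)).roots := by
    rw [roots_comp_neg_X]; exact logSep_roots_comp_neg hsep
  have hdvdn : ∀ {A B : ℝ[X]}, A ∣ B → A.comp (-X) ∣ B.comp (-X) := by
    rintro A _ ⟨B, rfl⟩
    exact ⟨B.comp (-X), by simp⟩
  have hHDn : H.comp (-X) ∣ dilDiff q l (G.comp (-X)) := by
    rw [dilDiff_comp_neg]; exact hdvdn hHD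
  have hbezn : ∀ x : ℝ, x ≠ 0 → (G.comp (-X)).eval x ≠ 0 →
      bez x (E.comp (-X)) (G.comp (-X)) ≠ 0 := by
    intro x hx h
    rw [bez_comp_neg, neg_ne_zero]
    exact hbez (-x) (by simpa) (by simpa using h)
  have hsimple : ∀ s, s ≠ 0 → H.eval s = 0 → (derivative H).eval s ≠ 0 := by
    intro s hs h0 h1
    have hd : ∀ {A : ℝ[X]}, H ∣ A → A.eval s = 0 ∧ (derivative A).eval s = 0 := by
      rintro _ ⟨A, rfl⟩
      simp [h0, h1]
    by_cases hGs : G.eval s = 0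
    · rcases lt_or_gt_of_ne hs with hs | hs
      · refine derivative_dilDiff_ne_zero hq hq1 hl hGn hsepn (s := -s) (by linarith)
          (by simpa) ?_ ?_
        · rw [dilDiff_comp_neg]; simpa using (hd hHD).1
        · rw [dilDiff_comp_neg, derivative_comp]; simpa using (hd hHD).2
      · exact derivative_dilDiff_ne_zero hq hq1 hl hG hsep hs hGs (hd hHD).1 (hd hHD).2
    · refine hbez s hs hGs ?_
      rw [bez_ofReal, (hd hHE).1, (hd hHE).2]; simp
  rw [logSep_roots_iff hH, strictLogSep_roots_iff hH]
  refine ⟨⟨fun s hs h h' => absurd h' (hsimple s hs h), fun s t hs hst h h' =>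
    (pos_separated hq hq1 hl hG hsep hHE hHD hbez hs hst h h').1, fun s t hs hst h h' =>
    (pos_separated hq hq1 hl hGn hsepn (hdvdn hHE) hHDn hbezn hs hst h h').1⟩, fun hstr =>
    ⟨fun s hs h h' => absurd h' (hsimple s hs h), fun s t hs hst h h' =>
    (pos_separated hq hq1 hl hG hsep hHE hHD hbez hs hst h h').2 hstr, fun s t hs hst h h' =>
    (pos_separated hq hq1 hl hGn hsepn (hdvdn hHE) hHDn hbezn hs hst h h').2 ?_⟩⟩
  rw [roots_comp_neg_X]; exact strictLogSep_roots_comp_neg hstr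

end sep

section shifts

variable {q : ℝ} {n : ℕ} {G : ℝ[X]}

lemma bez_dq_eq {w : ℝ → ℝ} (h : dq q G = ∑ y ∈ G.roots.toFinset, C (w y) * (G /ₘ (X - C y)))
    (z : ℂ) : bez z (dq q G) G = - ∑ y ∈ G.roots.toFinset, w y * sqAbs z (G /ₘ (X - C y)) := by
  rw [h, bez_sum_left, ← Finset.sum_neg_distrib]
  refine Finset.sum_congr rfl fun y hy => ?_
  rw [bez_C_mul_left, bez_divByMonic (Multiset.mem_toFinset.1 hy)]; ring

lemma pow_mul_qNum_inv_le (hq : 0 < q) {d : ℕ} (hd : d ≤ n + 1) :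
    q ^ n * qNum q⁻¹ d ≤ qNum q (n + 1) := by
  rw [← qNum_sub_add hq hd]
  have := qNum_nonneg hq (n + 1 - d); linarith

lemma bez_shiftUp_trunc_nonpos (hq : 0 < q) (hq1 : q ≤ 1) (hG : G ≠ 0)
    (hs : G.roots.card = G.natDegree) (hsep : LogSep q G.roots) (hdeg : G.natDegree ≤ n + 1)
    (z : ℂ) : bez z (shiftUp n q G) (trunc n q G) ≤ 0 := by
  obtain ⟨w, hw, h⟩ := inCone_dq hq hq1 hG hs hsep
  have hσ := sum_weights hG hs h
  have hb := qNum_pos hq n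
  have hle := pow_mul_qNum_inv_le hq hdeg
  rw [trunc, sub_eq_add_neg, ← neg_mul, ← C_neg, bez_add_right, bez_C_mul_right, bez_self_X_mul]
  have h1 := bez_dq_eq h z
  have h2 := sqAbs_sum_le z G.roots.toFinset w hw fun y => G /ₘ (X - C y)
  rw [← h, hσ] at h2
  have h3 : sqAbs z (shiftUp n q G) = (qNum q (n + 1))⁻¹ ^ 2 * sqAbs z (dq q G) := by
    rw [shiftUp, sqAbs, map_mul, aeval_C, Complex.normSq_mul, sqAbs]
    simp only [Complex.coe_algebraMap, Complex.normSq_ofReal]; ring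
  rw [h3, shiftUp, bez_C_mul_left, h1]
  set T := ∑ y ∈ G.roots.toFinset, w y * sqAbs z (G /ₘ (X - C y)) with hT
  have hT0 : 0 ≤ T := Finset.sum_nonneg fun y _ => mul_nonneg (hw y) (sqAbs_nonneg _ _)
  have h4 : q ^ n * sqAbs z (dq q G) ≤ qNum q (n + 1) * T := by
    calc q ^ n * sqAbs z (dq q G) ≤ q ^ n * (qNum q⁻¹ G.natDegree * T) := by gcongr
      _ = (q ^ n * qNum q⁻¹ G.natDegree) * T := by ring
      _ ≤ _ := by gcongr
  have h5 : (qNum q (n + 1))⁻¹ ^ 2 * (q ^ n * sqAbs z (dq q G)) ≤ (qNum q (n + 1))⁻¹ * T := by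
    calc _ ≤ (qNum q (n + 1))⁻¹ ^ 2 * (qNum q (n + 1) * T) := by gcongr
      _ = _ := by field_simp
  linarith

lemma aeval_divByMonic_ne_zero {z : ℂ} (hz : aeval z G ≠ 0) {y : ℝ} (hy : y ∈ G.roots) :
    aeval z (G /ₘ (X - C y)) ≠ 0 := by
  intro h
  apply hz
  rw [← X_sub_C_mul_divByMonic hy, map_mul, h, mul_zero]

lemma bez_shiftUp_neg (hq : 0 < q) (hq1 : q ≤ 1) (hG : G ≠ 0)
    (hs : G.roots.card = G.natDegree) (hsep : LogSep q G.roots) (h0 : shiftUp n q G ≠ 0)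
    {z : ℂ} (hz : aeval z G ≠ 0) : bez z (shiftUp n q G) G < 0 := by
  obtain ⟨w, hw, h⟩ := inCone_dq hq hq1 hG hs hsep
  have hb := qNum_pos hq n
  rw [shiftUp, bez_C_mul_left, bez_dq_eq h, mul_neg, neg_lt_zero]
  refine mul_pos (by positivity) ?_
  have hnn : ∀ y ∈ G.roots.toFinset, 0 ≤ w y * sqAbs z (G /ₘ (X - C y)) :=
    fun y _ => mul_nonneg (hw y) (sqAbs_nonneg _ _)
  refine lt_of_le_of_ne (Finset.sum_nonneg hnn) fun h1 => h0 ?_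
  rw [eq_comm, Finset.sum_eq_zero_iff_of_nonneg hnn] at h1
  rw [shiftUp, h, Finset.sum_eq_zero, mul_zero]
  intro y hy
  have := (mul_eq_zero.1 (h1 y hy)).resolve_right
    (sqAbs_pos (aeval_divByMonic_ne_zero hz (Multiset.mem_toFinset.1 hy))).ne'
  simp [this]

lemma bez_X_mul_trunc_pos (hq : 0 < q) (hq1 : q ≤ 1) (hG : G ≠ 0)
    (hs : G.roots.card = G.natDegree) (hsep : LogSep q G.roots) (hdeg : G.natDegree ≤ n + 1)
    (h0 : trunc n q G ≠ 0) {z : ℂ} (hz : aeval z G ≠ 0) : 0 < bez z (X * trunc n q G) G := by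
  obtain ⟨w, hw, h⟩ := inCone_dq hq hq1 hG hs hsep
  have hσ := sum_weights hG hs h
  have hb := qNum_pos hq n
  have hle := pow_mul_qNum_inv_le hq hdeg
  obtain ⟨κ, hκ⟩ : ∃ κ, κ = q ^ n / qNum q (n + 1) := ⟨_, rfl⟩
  obtain ⟨σ, hσ'⟩ : ∃ σ, σ = ∑ y ∈ G.roots.toFinset, w y := ⟨_, rfl⟩
  have hκ0 : 0 < κ := by rw [hκ]; positivity
  have hκσ : κ * σ ≤ 1 := by
    rw [hσ', hσ, hκ, div_mul_eq_mul_div, div_le_one hb]; exact hle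
  have hXG : ∀ y ∈ G.roots.toFinset,
      X * (G /ₘ (X - C y)) = G + C y * (G /ₘ (X - C y)) := by
    intro y hy
    have := X_sub_C_mul_divByMonic (Multiset.mem_toFinset.1 hy)
    linear_combination this
  have htr : trunc n q G = C (1 - κ * σ) * G
      + C (-κ) * ∑ y ∈ G.roots.toFinset, C (w y * y) * (G /ₘ (X - C y)) := by
    rw [trunc_eq, ← hκ, h, Finset.mul_sum,
      Finset.sum_congr rfl fun y hy => show X * (C (w y) * (G /ₘ (X - C y)))
        = C (w y) * G + C (w y * y) * (G /ₘ (X - C y)) by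
          rw [C_mul]; linear_combination (C (w y)) * hXG y hy,
      Finset.sum_add_distrib, ← Finset.sum_mul, ← map_sum, ← hσ', C_sub, C_mul, C_neg, C_1]
    ring
  have hbez : ∀ y ∈ G.roots.toFinset, bez z (X * (C (w y * y) * (G /ₘ (X - C y)))) G
      = - (w y * y ^ 2 * sqAbs z (G /ₘ (X - C y))) := by
    intro y hy
    rw [show X * (C (w y * y) * (G /ₘ (X - C y))) = C (w y * y) * G
        + C (w y * y * y) * (G /ₘ (X - C y)) by
      rw [C_mul (a := w y * y)]; linear_combination (C (w y * y)) * hXG y hy, bez_add_left, bez_C_mul_left,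
      bez_C_mul_left, bez_self, bez_divByMonic (Multiset.mem_toFinset.1 hy)]
    ring
  have hval : bez z (X * trunc n q G) G = (1 - κ * σ) * sqAbs z G
      + κ * ∑ y ∈ G.roots.toFinset, w y * y ^ 2 * sqAbs z (G /ₘ (X - C y)) := by
    rw [htr, show ∀ a b S : ℝ[X], X * (a * G + b * S) = a * (X * G) + b * (X * S) by
      intros; ring, bez_add_left, bez_C_mul_left, bez_C_mul_left, bez_antisymm, bez_self_X_mul,
      Finset.mul_sum, bez_sum_left, Finset.sum_congr rfl hbez, Finset.sum_neg_distrib]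
    ring
  rw [hval]
  have hnn : ∀ y ∈ G.roots.toFinset, 0 ≤ w y * y ^ 2 * sqAbs z (G /ₘ (X - C y)) :=
    fun y _ => mul_nonneg (mul_nonneg (hw y) (sq_nonneg _)) (sqAbs_nonneg _ _)
  have h1 : 0 ≤ (1 - κ * σ) * sqAbs z G := mul_nonneg (by linarith) (sqAbs_nonneg _ _)
  have h2 := mul_nonneg hκ0.le (Finset.sum_nonneg hnn)
  refine lt_of_le_of_ne (by linarith) fun h3 => h0 ?_
  have h4 : (1 - κ * σ) * sqAbs z G = 0 := by linarith
  have h5 := (mul_eq_zero.1 h4).resolve_right (sqAbs_pos hz).ne'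
  have h6 := (mul_eq_zero.1 (show κ * _ = 0 by linarith)).resolve_left hκ0.ne'
  rw [Finset.sum_eq_zero_iff_of_nonneg hnn] at h6
  rw [htr, h5, Finset.sum_eq_zero]
  · simp
  · intro y hy
    have := (mul_eq_zero.1 (h6 y hy)).resolve_right
      (sqAbs_pos (aeval_divByMonic_ne_zero hz (Multiset.mem_toFinset.1 hy))).ne'
    have : w y * y = 0 := by
      rcases mul_eq_zero.1 this with h | h
      · simp [h]
      · simp [(pow_eq_zero_iff two_ne_zero).1 h]
    simp [this]

lemma card_roots_shiftUp (hq : 0 < q) (hq1 : q ≤ 1) (hG : G ≠ 0)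
    (hs : G.roots.card = G.natDegree) (hsep : LogSep q G.roots) (h0 : shiftUp n q G ≠ 0) :
    (shiftUp n q G).roots.card = (shiftUp n q G).natDegree := by
  refine card_roots_of_forall_nonreal h0 fun z hz h => ?_
  have := bez_shiftUp_neg hq hq1 hG hs hsep h0 (aeval_ne_zero_of_card_roots hG hs hz)
  rw [bez_eq_zero_of_nonreal hz h] at this
  exact lt_irrefl _ this

lemma card_roots_trunc (hq : 0 < q) (hq1 : q ≤ 1) (hG : G ≠ 0)
    (hs : G.roots.card = G.natDegree) (hsep : LogSep q G.roots) (hdeg : G.natDegree ≤ n + 1)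
    (h0 : trunc n q G ≠ 0) : (trunc n q G).roots.card = (trunc n q G).natDegree := by
  refine card_roots_of_forall_nonreal h0 fun z hz h => ?_
  have := bez_X_mul_trunc_pos hq hq1 hG hs hsep hdeg h0 (aeval_ne_zero_of_card_roots hG hs hz)
  rw [bez_eq_zero_of_nonreal hz (by simp [h])] at this
  exact lt_irrefl _ this

lemma aeval_ofReal_eq_zero_iff {x : ℝ} {P : ℝ[X]} : aeval (x : ℂ) P = 0 ↔ P.eval x = 0 := by
  have := aeval_eq_zero_iff_of_im_eq_zero (z := (x : ℂ)) (by simp) P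
  simpa using this

lemma logSep_of_bez_ne_zero (hq : 0 < q) (hq1 : q ≤ 1) {l : ℝ} (hl : 0 < l) (hG : G ≠ 0)
    (hsep : LogSep q G.roots) {H E : ℝ[X]} (hH : H ≠ 0) (hHE : H ∣ E)
    (hHD : q < 1 → H ∣ dilDiff q l G)
    (hbez : ∀ x : ℝ, x ≠ 0 → G.eval x ≠ 0 → bez x E G ≠ 0)
    (hcom : ∀ x, x ≠ 0 → G.eval x = 0 → H.eval x = 0 → (dq q G).eval x = 0) :
    LogSep q H.roots ∧ (StrictLogSep q G.roots → StrictLogSep q H.roots) := by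
  rcases hq1.eq_or_lt with rfl | hq1'
  · refine ⟨logSep_one _, fun hstr => (strictLogSep_roots_iff hH).2
      ⟨fun s hs h0 h1 => ?_, fun s t _ h _ _ => by linarith, fun s t _ h _ _ => by linarith⟩⟩
    by_cases hGs : G.eval s = 0
    · exact absurd (hcom s hs hGs h0) (dq_eval_ne_zero hq le_rfl hG hstr hs hGs)
    · refine absurd ?_ (hbez s hs hGs)
      obtain ⟨A, rfl⟩ := hHE
      rw [bez_ofReal]; simp [h0, h1]
  · exact logSep_of_dvd_dilDiff hq hq1' hl hG hsep hH hHE (hHD hq1') hbez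

lemma logSep_shiftUp (hq : 0 < q) (hq1 : q ≤ 1) (hG : G ≠ 0)
    (hs : G.roots.card = G.natDegree) (hsep : LogSep q G.roots) (h0 : shiftUp n q G ≠ 0) :
    LogSep q (shiftUp n q G).roots ∧
      (StrictLogSep q G.roots → StrictLogSep q (shiftUp n q G).roots) := by
  have hb := qNum_pos hq n
  refine logSep_of_bez_ne_zero hq hq1 one_pos hG hsep h0 dvd_rfl (fun hq1' => ?_)
    (fun x _ hx => ?_) fun x _ _ hx => ?_
  · refine ⟨C (-((1 - q) / q) * qNum q (n + 1)) * X, ?_⟩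
    rw [dilDiff, comp_inv_mul hq, shiftUp]
    have : C (qNum q (n + 1))⁻¹ * C (qNum q (n + 1)) = (1 : ℝ[X]) := by
      rw [← C_mul, inv_mul_cancel₀ hb.ne', C_1]
    rw [C_mul, C_neg, C_1]
    linear_combination (C ((1 - q) / q) * X * dq q G) * this
  · exact (bez_shiftUp_neg hq hq1 hG hs hsep h0 (mt aeval_ofReal_eq_zero_iff.1 hx)).ne
  · simpa [shiftUp, hb.ne'] using hx

lemma logSep_trunc (hq : 0 < q) (hq1 : q ≤ 1) (hG : G ≠ 0)
    (hs : G.roots.card = G.natDegree) (hsep : LogSep q G.roots) (hdeg : G.natDegree ≤ n + 1)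
    (h0 : trunc n q G ≠ 0) : LogSep q (trunc n q G).roots ∧
      (StrictLogSep q G.roots → StrictLogSep q (trunc n q G).roots) := by
  have hb := qNum_pos hq n
  refine logSep_of_bez_ne_zero hq hq1 (l := q ^ (n + 1)) (by positivity) hG hsep h0
    (E := X * trunc n q G) (dvd_mul_left _ _) (fun hq1' => ?_) (fun x _ hx => ?_)
    fun x hx0 hGx hx => ?_
  · refine ⟨C (1 - q ^ (n + 1)), ?_⟩
    rw [dilDiff, comp_inv_mul hq, trunc_eq]
    have h1 : q ^ (n + 1) * ((1 - q) / q) = q ^ n / qNum q (n + 1) * (1 - q ^ (n + 1)) := by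
      have := mul_neg_geom_sum q (n + 1)
      rw [← qNum] at this
      field_simp
      linear_combination (q ^ (n + 1)) * this
    have h2 := congrArg (C (R := ℝ)) h1
    rw [C_mul, C_mul] at h2
    rw [C_sub, C_1]
    rw [C_sub, C_1] at h2
    linear_combination (-X * dq q G) * h2
  · exact (bez_X_mul_trunc_pos hq hq1 hG hs hsep hdeg h0 (mt aeval_ofReal_eq_zero_iff.1 hx)).ne'
  · rw [trunc_eq] at hx
    simp only [eval_sub, eval_mul, eval_C, eval_X, hGx, zero_sub, neg_eq_zero, mul_eq_zero] at hx
    rcases hx with h | h | h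
    · have : q ^ n / qNum q (n + 1) ≠ 0 := by positivity
      exact absurd h this
    · exact absurd h hx0
    · exact h

lemma strictLogSep_zero : StrictLogSep q 0 := by simp [StrictLogSep]

lemma memR_zero : memR n q 0 := by
  simp [memR, RealRooted, strictLogSep_zero]

lemma memR.card_roots (h : memR n q G) (h0 : G ≠ 0) : G.roots.card = G.natDegree :=
  h.2.1.resolve_left h0

lemma memR_shiftUp (hq : 0 < q) (hq1 : q ≤ 1) (h : memR (n + 1) q G) :
    memR n q (shiftUp n q G) := by
  by_cases h0 : shiftUp n q G = 0
  · rw [h0]; exact memR_zero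
  have hG : G ≠ 0 := by rintro rfl; simp [shiftUp, dq_zero] at h0
  have hs := h.card_roots hG
  exact ⟨natDegree_shiftUp_le q h.1, Or.inr (card_roots_shiftUp hq hq1 hG hs h.2.2.logSep h0),
    (logSep_shiftUp hq hq1 hG hs h.2.2.logSep h0).2 h.2.2⟩

lemma memR_trunc (hq : 0 < q) (hq1 : q ≤ 1) (h : memR (n + 1) q G) :
    memR n q (trunc n q G) := by
  by_cases h0 : trunc n q G = 0
  · rw [h0]; exact memR_zero
  have hG : G ≠ 0 := by rintro rfl; simp [trunc, shiftUp, dq_zero] at h0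
  have hs := h.card_roots hG
  exact ⟨natDegree_trunc_le hq h.1,
    Or.inr (card_roots_trunc hq hq1 hG hs h.2.2.logSep h.1 h0),
    (logSep_trunc hq hq1 hG hs h.2.2.logSep h.1 h0).2 h.2.2⟩

lemma not_common_zero (hq : 0 < q) (hq1 : q ≤ 1) (h : memR (n + 1) q G) (hG : G ≠ 0) {z : ℂ}
    (hz : z ≠ 0) : ¬ (aeval z (shiftUp n q G) = 0 ∧ aeval z (trunc n q G) = 0) := by
  rintro ⟨h1, h2⟩
  have hb := qNum_pos hq n
  have h3 : aeval z G = 0 := by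
    rw [trunc] at h2
    simpa [h1] using h2
  have him : z.im = 0 := by
    by_contra him
    exact aeval_ne_zero_of_card_roots hG (h.card_roots hG) him h3
  rw [aeval_eq_zero_iff_of_im_eq_zero him] at h1 h3
  refine dq_eval_ne_zero hq hq1 hG h.2.2 (s := z.re) (fun hre => hz (Complex.ext hre him)) h3 ?_
  simpa [shiftUp, hb.ne'] using h1

end shifts

lemma two_mul_coeff_zero_mul_coeff_two_lt {P : ℝ[X]} (hs : P.roots.card = P.natDegree)
    (h0 : P.coeff 0 ≠ 0) (hd : 1 ≤ P.natDegree) : 2 * (P.coeff 0 * P.coeff 2) < P.coeff 1 ^ 2 := by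
  have hP : P ≠ 0 := by rintro rfl; simp at h0
  have hsh : shiftUp 0 1 P = derivative P := by simp [shiftUp, dq_one, qNum]
  have hne : shiftUp 0 1 P ≠ 0 := by
    rw [hsh]
    intro h
    have := derivative_eq_zero.1 h
    omega
  have hz : aeval ((0 : ℝ) : ℂ) P ≠ 0 := by
    rw [Ne, aeval_ofReal_eq_zero_iff, ← coeff_zero_eq_eval_zero]; exact h0
  have := bez_shiftUp_neg one_pos le_rfl hP hs (logSep_one _) hne hz
  rw [hsh, bez_ofReal] at this
  simp only [← coeff_zero_eq_eval_zero, coeff_derivative] at this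
  norm_num at this
  nlinarith

lemma card_roots_derivative {P : ℝ[X]} (hs : P.roots.card = P.natDegree) :
    (derivative P).roots.card = (derivative P).natDegree := by
  have h1 := card_roots_le_derivative P
  have h2 := card_roots' (derivative P)
  have h3 : (derivative P).natDegree = P.natDegree - 1 := natDegree_derivative P
  omega

lemma not_consecutive_zero_coeff_of_coeff_zero_ne {k : ℕ} : ∀ {P : ℝ[X]},
    P.roots.card = P.natDegree → P.coeff 0 ≠ 0 → k + 1 ≤ P.natDegree →
    ¬ (P.coeff k = 0 ∧ P.coeff (k + 1) = 0) := by
  induction k using Nat.strong_induction_on with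
  | _ k ih =>
    intro P hs h0 hd ⟨hk, hk1⟩
    have hN := two_mul_coeff_zero_mul_coeff_two_lt hs h0 (by omega)
    have hs' := card_roots_derivative hs
    have hd' : (derivative P).natDegree = P.natDegree - 1 := natDegree_derivative P
    rcases k with _ | k
    · exact h0 hk
    by_cases h1 : P.coeff 1 = 0
    · have h2 : P.coeff 2 ≠ 0 := by
        rintro h2; simp [h1, h2] at hN
      rcases k with _ | k
      · exact h2 hk1
      have hd'' : (derivative (derivative P)).natDegree = (derivative P).natDegree - 1 :=
        natDegree_derivative _
      refine ih k (by omega) (card_roots_derivative hs') ?_ (by omega) ⟨?_, ?_⟩ <;>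
        simp only [coeff_derivative]
      · norm_num; exact h2
      · simp [show k + 1 + 1 = k + 2 by ring] at hk ⊢; simp [hk]
      · simp [hk1]
    · refine ih k (by omega) hs' ?_ (by omega) ⟨?_, ?_⟩ <;> simp only [coeff_derivative]
      · norm_num; exact h1
      · simp [hk]
      · simp [hk1]

lemma not_consecutive_zero_coeff {j k : ℕ} : ∀ {P : ℝ[X]}, P.roots.card = P.natDegree →
    P.coeff j ≠ 0 → j ≤ k → k + 1 ≤ P.natDegree → ¬ (P.coeff k = 0 ∧ P.coeff (k + 1) = 0) := by
  induction j generalizing k with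
  | zero => intro P hs h0 _ hd; exact not_consecutive_zero_coeff_of_coeff_zero_ne hs h0 hd
  | succ j ih =>
    intro P hs hj hjk hd
    by_cases h0 : P.coeff 0 = 0
    · obtain ⟨Q, rfl⟩ := X_dvd_iff.2 h0
      obtain ⟨k, rfl⟩ : ∃ l, k = l + 1 := ⟨k - 1, by omega⟩
      have hQ : Q ≠ 0 := by rintro rfl; simp at hj
      rw [natDegree_X_mul hQ] at hs hd
      rw [roots_mul (mul_ne_zero X_ne_zero hQ), roots_X] at hs
      simp only [coeff_X_mul] at hj ⊢
      exact ih (by simpa using (by simpa [add_comm] using hs)) hj (by omega) (by omega)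
    · exact not_consecutive_zero_coeff_of_coeff_zero_ne hs h0 hd

lemma leadingCoeff_mul_coeff_pos {d : ℕ} : ∀ {P : ℝ[X]}, P ≠ 0 → P.natDegree = d →
    P.roots.card = P.natDegree → (∀ x ∈ P.roots, x < 0) → ∀ {k : ℕ}, k ≤ d →
    0 < P.leadingCoeff * P.coeff k := by
  induction d with
  | zero =>
    intro P hP hd _ _ k hk
    obtain rfl : k = 0 := by omega
    rw [leadingCoeff, hd]
    refine mul_self_pos.2 ?_
    rw [← hd]
    exact leadingCoeff_ne_zero.2 hP
  | succ d ih =>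
    intro P hP hd hs hneg k hk
    obtain ⟨y, hy⟩ : ∃ y, y ∈ P.roots := by
      apply Multiset.exists_mem_of_ne_zero
      intro h
      rw [h, Multiset.card_zero] at hs
      omega
    have hQd := natDegree_divByMonic_X_sub_C P y
    have hroots := roots_divByMonic hy
    have hQ : ∀ {j : ℕ}, j ≤ d → 0 < P.leadingCoeff * (P /ₘ (X - C y)).coeff j := by
      rw [← leadingCoeff_divByMonic_X_sub_C hy]
      refine ih (divByMonic_ne_zero hy) (by omega) (card_roots_divByMonic hy hs) fun x hx => ?_
      exact hneg x (by rw [hroots]; exact Multiset.mem_cons_of_mem hx)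
    have hy0 := hneg y hy
    have hmul := X_sub_C_mul_divByMonic hy
    have hk' : P.coeff k = (if k = 0 then 0 else (P /ₘ (X - C y)).coeff (k - 1))
        - y * (P /ₘ (X - C y)).coeff k := by
      conv_lhs => rw [← hmul]
      rw [sub_mul, coeff_sub, coeff_C_mul]
      rcases k with _ | k <;> simp
    rw [hk', mul_sub]
    rcases k with _ | k
    · have := mul_pos_of_neg_of_neg hy0 (neg_lt_zero.2 (hQ (Nat.zero_le d)))
      simp only [if_true]
      nlinarith
    · have h1 := hQ (show k ≤ d by omega)
      simp only [Nat.succ_ne_zero, if_false, Nat.add_sub_cancel]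
      rcases hk.lt_or_eq with h | h
      · have := mul_pos_of_neg_of_neg hy0 (neg_lt_zero.2 (hQ (show k + 1 ≤ d by omega)))
        nlinarith
      · have : (P /ₘ (X - C y)).coeff (k + 1) = 0 := coeff_eq_zero_of_natDegree_lt (by omega)
        rw [this]; simpa using h1

lemma eval_ne_zero_of_coeff_pos {n : ℕ} {c : ℝ} {P : ℝ[X]} (hn : P.natDegree ≤ n)
    (h : ∀ k ≤ n, 0 < c * P.coeff k) {x : ℝ} (hx : 0 ≤ x) : P.eval x ≠ 0 := by
  intro h0
  have h1 : c * P.eval x = ∑ k ∈ Finset.range (n + 1), c * P.coeff k * x ^ k := by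
    rw [eval_eq_sum_range' (Nat.lt_succ_of_le hn), Finset.mul_sum]
    exact Finset.sum_congr rfl fun _ _ => by ring
  have h2 : 0 < ∑ k ∈ Finset.range (n + 1), c * P.coeff k * x ^ k :=
    Finset.sum_pos' (fun k hk => mul_nonneg (h k (by simpa [Nat.lt_succ_iff] using hk)).le
      (pow_nonneg hx k)) ⟨0, by simp, by simpa using h 0 (Nat.zero_le n)⟩
  rw [← h1, h0, mul_zero] at h2
  exact lt_irrefl _ h2

/-- The polynomials of exact degree `n` with negative, logarithmically `q`-separated zeros. -/
structure NegSep (n : ℕ) (q : ℝ) (F : ℝ[X]) : Prop where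
  ne_zero : F ≠ 0
  card : F.roots.card = F.natDegree
  natDegree : F.natDegree = n
  neg : ∀ x ∈ F.roots, x < 0
  sep : LogSep q F.roots

section
variable {q : ℝ} {n : ℕ} {F : ℝ[X]}

lemma NegSep.coeff_pos (h : NegSep n q F) {k : ℕ} (hk : k ≤ n) :
    0 < F.leadingCoeff * F.coeff k :=
  leadingCoeff_mul_coeff_pos h.ne_zero h.natDegree h.card h.neg hk

lemma NegSep.coeff_ne_zero (h : NegSep n q F) {k : ℕ} (hk : k ≤ n) : F.coeff k ≠ 0 :=
  right_ne_zero_of_mul (h.coeff_pos hk).ne'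

lemma NegSep.divByMonic (h : NegSep (n + 1) q F) {s : ℝ} (hs : s ∈ F.roots) :
    NegSep n q (F /ₘ (X - C s)) := by
  have hr := roots_divByMonic hs
  refine ⟨divByMonic_ne_zero hs, card_roots_divByMonic hs h.card, ?_, fun x hx => h.neg x ?_,
    h.sep.of_le ?_⟩
  · rw [natDegree_divByMonic_X_sub_C, h.natDegree]; rfl
  · rw [hr]; exact Multiset.mem_cons_of_mem hx
  · rw [hr]; exact Multiset.le_cons_self _ _

lemma NegSep.negSep_trunc (hq : 0 < q) (hq1 : q ≤ 1) (h : NegSep (n + 1) q F) :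
    NegSep n q (trunc n q F) := by
  have hc : ∀ k ≤ n, 0 < F.leadingCoeff * (trunc n q F).coeff k := by
    intro k hk
    rw [coeff_trunc hq (by omega), ← mul_assoc]
    refine mul_pos (h.coeff_pos (by omega)) (div_pos ?_ (qNum_pos hq n))
    rw [show n + 1 - k = (n - k) + 1 by omega]; exact qNum_pos hq _
  have hd := natDegree_trunc_le hq h.natDegree.le
  have h0 : trunc n q F ≠ 0 := by
    intro h0; have := hc 0 (Nat.zero_le n); simp [h0] at this
  refine ⟨h0, card_roots_trunc hq hq1 h.ne_zero h.card h.sep h.natDegree.le h0,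
    le_antisymm hd (le_natDegree_of_ne_zero (right_ne_zero_of_mul (hc n le_rfl).ne')), ?_,
    (logSep_trunc hq hq1 h.ne_zero h.card h.sep h.natDegree.le h0).1⟩
  intro x hx
  by_contra hx0
  exact eval_ne_zero_of_coeff_pos hd hc (not_lt.1 hx0) ((mem_roots h0).1 hx)

end

section
variable {q : ℝ} {n : ℕ} {F G H : ℝ[X]}

lemma natDegree_shiftUp_le_natDegree_trunc (hq : 0 < q) (hs : G.roots.card = G.natDegree)
    (hdeg : G.natDegree ≤ n + 1) (h0 : trunc n q G ≠ 0) :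
    (shiftUp n q G).natDegree ≤ (trunc n q G).natDegree + 1 := by
  have hpos : ∀ k ≤ n, (trunc n q G).coeff k ≠ 0 ↔ G.coeff k ≠ 0 := by
    intro k hk
    rw [coeff_trunc hq (by omega)]
    have h1 : 0 < qNum q (n + 1 - k) := by
      rw [show n + 1 - k = (n - k) + 1 by omega]; exact qNum_pos hq _
    have := div_pos h1 (qNum_pos hq n)
    simp [this.ne']
  rcases hdeg.lt_or_eq with h | h
  · have h1 : (shiftUp n q G).natDegree ≤ G.natDegree - 1 :=
      (natDegree_C_mul_le _ _).trans (natDegree_dq_le q G)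
    have hG : G ≠ 0 := by rintro rfl; simp [trunc, shiftUp, dq_zero] at h0
    have := le_natDegree_of_ne_zero ((hpos _ (Nat.lt_succ_iff.1 h)).2 (leadingCoeff_ne_zero.2 hG))
    omega
  · have h1 := natDegree_shiftUp_le q hdeg
    rcases n with _ | n
    · omega
    by_cases hc : G.coeff (n + 1) = 0
    · have hj := leadingCoeff_ne_zero.2 h0
      rw [leadingCoeff] at hj
      have hjn := natDegree_trunc_le hq hdeg
      have hj' := (hpos _ hjn).1 hj
      have : G.coeff n ≠ 0 := by
        intro hn
        refine not_consecutive_zero_coeff hs hj' ?_ (by omega) ⟨hn, hc⟩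
        rcases hjn.lt_or_eq with h' | h'
        · omega
        · rw [h'] at hj'; exact absurd hc hj'
      have := le_natDegree_of_ne_zero ((hpos n (by omega)).2 this)
      omega
    · have := le_natDegree_of_ne_zero ((hpos (n + 1) le_rfl).2 hc)
      omega

lemma qHadamard_of_coeff_eq (hq : 0 < q) {h w : ℝ}
    (hH : ∀ k ≤ n, H.coeff k = h * w ^ k * qBinom n k q) (hG : G.natDegree ≤ n) :
    qHadamard n q H G = C h * G.comp (C w * X) := by
  ext k
  rw [coeff_qHadamard, coeff_C_mul, comp_C_mul_X_coeff]
  rcases le_or_gt k n with hk | hk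
  · rw [hH k hk]
    have := (qBinom_pos hq hk).ne'
    field_simp
  · rw [coeff_eq_zero_of_natDegree_lt (hG.trans_lt hk)]; simp

lemma coeff_eq_of_shiftUp_eq (hq : 0 < q) {w : ℝ} (h : shiftUp n q H = C w * trunc n q H) :
    ∀ {k : ℕ}, k ≤ n + 1 → H.coeff k = H.coeff 0 * w ^ k * qBinom (n + 1) k q := by
  intro k
  induction k with
  | zero => simp [qBinom_zero_right]
  | succ k ih =>
    intro hk
    have h1 := congrArg (fun P => P.coeff k) h
    simp only [coeff_C_mul, coeff_shiftUp, coeff_trunc hq (show k ≤ n + 1 by omega)] at h1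
    have h2 := qNum_inv_mul_qBinom hq n k
    rw [← qNum_mul_qBinom hq (show k ≤ n by omega)] at h2
    have h3 := qNum_pos hq n
    have h4 := qNum_pos (inv_pos.2 hq) k
    rw [ih (by omega)] at h1
    field_simp at h1
    rw [one_div] at h1
    apply mul_left_cancel₀ h4.ne'
    linear_combination h1 - H.coeff 0 * w ^ (k + 1) * h2

/-- The convolution of `H` with the two shifts of `G` preserves their interlacing. -/
def PreservesInterlacing (n : ℕ) (q : ℝ) (H : ℝ[X]) : Prop :=
  ∀ G, memR (n + 1) q G → G ≠ 0 → ∀ z : ℂ, z ≠ 0 →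
    bez z (qHadamard n q H (shiftUp n q G)) (qHadamard n q H (trunc n q G)) ≤ 0 ∧
    ¬ (aeval z (qHadamard n q H (shiftUp n q G)) = 0 ∧
      aeval z (qHadamard n q H (trunc n q G)) = 0)

/-- The convolutions of the two shifts of `F` with members of `𝓡_n(q)` interlace strictly. -/
def StrictlyInterlaces (n : ℕ) (q : ℝ) (F : ℝ[X]) : Prop :=
  ∀ K, memR n q K → K ≠ 0 → ∀ z : ℂ, z ≠ 0 →
    bez z (qHadamard n q K (trunc n q F)) (X * qHadamard n q K (shiftUp n q F)) < 0

lemma preservesInterlacing_of_coeff_eq (hq : 0 < q) (hq1 : q ≤ 1) {h w : ℝ} (hh : h ≠ 0)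
    (hw : 0 < w) (hH : ∀ k ≤ n, H.coeff k = h * w ^ k * qBinom n k q) :
    PreservesInterlacing n q H := by
  intro G hG hG0 z hz
  have hwz : (w : ℂ) * z ≠ 0 := mul_ne_zero (by exact_mod_cast hw.ne') hz
  have haev : ∀ P : ℝ[X], aeval z (C h * P.comp (C w * X)) = 0 → aeval ((w : ℂ) * z) P = 0 := by
    intro P hP
    rw [map_mul, aeval_C, aeval_comp] at hP
    simpa [hh] using hP
  rw [qHadamard_of_coeff_eq hq hH (natDegree_shiftUp_le q hG.1),
    qHadamard_of_coeff_eq hq hH (natDegree_trunc_le hq hG.1)]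
  refine ⟨?_, fun h' => not_common_zero hq hq1 hG hG0 hwz ⟨haev _ h'.1, haev _ h'.2⟩⟩
  rw [bez_C_mul_left, bez_C_mul_right, bez_comp_scale z hw.ne']
  have := bez_shiftUp_trunc_nonpos hq hq1 hG0 (hG.card_roots hG0) hG.2.2.logSep hG.1 (w * z)
  have h1 := mul_nonpos_of_nonneg_of_nonpos hw.le this
  nlinarith [mul_self_nonneg h]

lemma strictlyInterlaces_succ (hq : 0 < q) (hq1 : q ≤ 1)
    (hB : ∀ H, NegSep n q H → PreservesInterlacing n q H)
    (hF : NegSep (n + 2) q F) (hne : ∀ w, shiftUp (n + 1) q F ≠ C w * trunc (n + 1) q F) :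
    StrictlyInterlaces (n + 1) q F := by
  intro K hK hK0 z hz
  have hD := hF.negSep_trunc hq hq1
  have hQd := natDegree_shiftUp_le q hF.natDegree.le
  have hbz := bez_shiftUp_trunc_nonpos hq hq1 hF.ne_zero hF.card hF.sep hF.natDegree.le
  have hQc := coeff_shiftUp (n + 1) q F (n + 1)
  have hDc := coeff_trunc hq (n := n + 1) (k := n + 1) (by omega) F
  set D := trunc (n + 1) q F with hDdef
  set Q := shiftUp (n + 1) q F with hQdef
  obtain ⟨e, c, w, -, hw, hec, hcc, hQ⟩ := partial_fractions hD.ne_zero hD.card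
    (by rw [hD.natDegree]; omega) hbz
  have hlc := leadingCoeff_ne_zero.2 hD.ne_zero
  have he : e = 0 := by
    rw [coeff_eq_zero_of_natDegree_lt (by rw [hD.natDegree]; omega)] at hec
    simpa [hlc] using hec.symm
  have hc : 0 < c := by
    have h1 := hcc he
    rw [leadingCoeff, hD.natDegree, hQc, hDc] at h1
    have h2 := hF.coeff_pos (k := n + 2) le_rfl
    have h3 := hF.coeff_pos (k := n + 1) (by omega)
    have h4 := div_pos (qNum_pos (inv_pos.2 hq) (n + 1)) (qNum_pos hq (n + 1))
    have h5 : 0 < qNum q (n + 1 + 1 - (n + 1)) / qNum q (n + 1 + 1) := by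
      rw [show n + 1 + 1 - (n + 1) = 0 + 1 by omega]
      exact div_pos (qNum_pos hq 0) (qNum_pos hq _)
    have h6 := mul_pos h2 h4
    have h7 := mul_pos h3 h5
    by_contra hc
    nlinarith [mul_nonneg (sub_nonneg.2 (not_lt.1 hc)) h7.le, congrArg (F.leadingCoeff * ·) h1]
  set P := qHadamard (n + 1) q K D with hPdef
  set A : ℝ → ℝ[X] := fun s => qHadamard n q (D /ₘ (X - C s)) (trunc n q K) with hA
  set B : ℝ → ℝ[X] := fun s => qHadamard n q (D /ₘ (X - C s)) (shiftUp n q K) with hB'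
  have hNs : ∀ s ∈ D.roots.toFinset, NegSep n q (D /ₘ (X - C s)) :=
    fun s hs => hD.divByMonic (Multiset.mem_toFinset.1 hs)
  have hAB : ∀ s ∈ D.roots.toFinset, P = X * B s + C (-s) * A s := by
    intro s hs
    rw [hPdef, qHadamard_comm, hA, hB', ← qHadamard_X_sub_C_mul hq (hNs s hs).natDegree.le,
      X_sub_C_mul_divByMonic (Multiset.mem_toFinset.1 hs)]
  have hKQ : qHadamard (n + 1) q K Q = C c * P + ∑ s ∈ D.roots.toFinset, C (w s) * A s := by
    rw [hQ, he, C_0, zero_mul, zero_add, qHadamard_add_right, qHadamard_C_mul_right]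
    congr 1
    rw [qHadamard_comm, qHadamard_sum_left]
    refine Finset.sum_congr rfl fun s hs => ?_
    rw [qHadamard_C_mul_left, qHadamard_eq_trunc hq (hNs s hs).natDegree.le]
  have hterm : ∀ s ∈ D.roots.toFinset, bez z P (X * A s)
      = Complex.normSq z * bez z (B s) (A s) + s * sqAbs z (A s) := by
    intro s hs
    rw [hAB s hs, bez_add_left, bez_X_mul_X_mul, bez_C_mul_left, bez_self_X_mul]; ring
  have hval : bez z P (X * qHadamard (n + 1) q K Q) = -(c * sqAbs z P)
      + ∑ s ∈ D.roots.toFinset, w s * bez z P (X * A s) := by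
    rw [hKQ, mul_add, bez_add_right, mul_left_comm, bez_C_mul_right, bez_self_X_mul,
      Finset.mul_sum, bez_sum_right]
    congr 1
    · ring
    · exact Finset.sum_congr rfl fun s _ => by rw [mul_left_comm, bez_C_mul_right]
  have hneg : ∀ s ∈ D.roots.toFinset, s < 0 := fun s hs => hD.neg s (Multiset.mem_toFinset.1 hs)
  have hle1 : ∀ s ∈ D.roots.toFinset, Complex.normSq z * bez z (B s) (A s) ≤ 0 := fun s hs =>
    mul_nonpos_of_nonneg_of_nonpos (Complex.normSq_nonneg z) (hB _ (hNs s hs) K hK hK0 z hz).1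
  have hle2 : ∀ s ∈ D.roots.toFinset, s * sqAbs z (A s) ≤ 0 := fun s hs =>
    mul_nonpos_of_nonpos_of_nonneg (hneg s hs).le (sqAbs_nonneg _ _)
  have hle : ∀ s ∈ D.roots.toFinset, w s * bez z P (X * A s) ≤ 0 := fun s hs => by
    rw [hterm s hs]
    exact mul_nonpos_of_nonneg_of_nonpos (hw s) (by linarith [hle1 s hs, hle2 s hs])
  have hP0 : 0 ≤ c * sqAbs z P := mul_nonneg hc.le (sqAbs_nonneg _ _)
  have hsum := Finset.sum_nonpos hle
  rw [hval]
  refine lt_of_le_of_ne (by linarith) fun h0 => ?_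
  have hPz : aeval z P = 0 := by
    have : c * sqAbs z P = 0 := by linarith
    exact sqAbs_eq_zero.1 ((mul_eq_zero.1 this).resolve_left hc.ne')
  have hall := (Finset.sum_eq_zero_iff_of_nonpos hle).1 (by linarith)
  obtain ⟨s, hs, hws⟩ : ∃ s ∈ D.roots.toFinset, w s ≠ 0 := by
    by_contra! hcon
    refine hne c ?_
    rw [hQ, he, Finset.sum_eq_zero fun s hs => by rw [hcon s hs]; simp]
    simp
  have h1 := (mul_eq_zero.1 (hall s hs)).resolve_left hws
  rw [hterm s hs] at h1
  have h2 : s * sqAbs z (A s) = 0 := by linarith [hle1 s hs, hle2 s hs]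
  have hAz : aeval z (A s) = 0 :=
    sqAbs_eq_zero.1 ((mul_eq_zero.1 h2).resolve_left (hneg s hs).ne)
  refine (hB _ (hNs s hs) K hK hK0 z hz).2 ⟨?_, hAz⟩
  have h3 := hPz
  rw [hAB s hs, map_add, map_mul, map_mul, hAz, mul_zero, add_zero, aeval_X] at h3
  exact (mul_eq_zero.1 h3).resolve_left hz

lemma strictlyInterlaces_zero (hq : 0 < q) (hq1 : q ≤ 1) (hF : NegSep 1 q F)
    (hne : ∀ w, shiftUp 0 q F ≠ C w * trunc 0 q F) : StrictlyInterlaces 0 q F := by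
  exfalso
  have hD := (hF.negSep_trunc hq hq1).natDegree
  have hD0 := (hF.negSep_trunc hq hq1).ne_zero
  have hQ := natDegree_shiftUp_le q hF.natDegree.le
  rw [eq_C_of_natDegree_eq_zero hD] at hD0
  apply hne ((shiftUp 0 q F).coeff 0 / (trunc 0 q F).coeff 0)
  rw [eq_C_of_natDegree_le_zero hQ, eq_C_of_natDegree_eq_zero hD, ← C_mul]
  have : (trunc 0 q F).coeff 0 ≠ 0 := fun h => hD0 (by rw [h, C_0])
  simp only [coeff_C_zero]
  rw [div_mul_cancel₀ _ this]

end

section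
variable {q : ℝ} {n : ℕ} {F G H : ℝ[X]}

lemma memR.divByMonic (h : memR (n + 1) q G) (hG : G ≠ 0) {s : ℝ} (hs : s ∈ G.roots) :
    memR n q (G /ₘ (X - C s)) := by
  refine ⟨?_, Or.inr (card_roots_divByMonic hs (h.card_roots hG)), h.2.2.of_le ?_⟩
  · rw [natDegree_divByMonic_X_sub_C]; have := h.1; omega
  · rw [roots_divByMonic hs]; exact Multiset.le_cons_self _ _

lemma aeval_eq_zero_only_at_zero {P : ℝ[X]} {k : ℕ}
    (hP : ∀ j, j ≠ k → P.coeff j = 0) (hk : P.coeff k ≠ 0) {z : ℂ} (hz : z ≠ 0) :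
    aeval z P ≠ 0 := by
  have : P = C (P.coeff k) * X ^ k := by
    ext j
    rw [coeff_C_mul_X_pow]
    split_ifs with h
    · rw [h]
    · exact hP j h
  rw [this]
  simp [hz, hk]

lemma NegSep.aeval_qHadamard_monomial (hH : NegSep n q H) (hq : 0 < q) {k : ℕ} (hk : k ≤ n)
    {a : ℝ} (ha : a ≠ 0) {z : ℂ} (hz : z ≠ 0) :
    aeval z (qHadamard n q H (C a * X ^ k)) ≠ 0 := by
  refine aeval_eq_zero_only_at_zero (k := k) ?_ ?_ hz
  · intro j hj
    rw [coeff_qHadamard, coeff_C_mul_X_pow, if_neg hj]; simp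
  · rw [coeff_qHadamard, coeff_C_mul_X_pow, if_pos rfl]
    exact div_ne_zero (mul_ne_zero (hH.coeff_ne_zero hk) ha) (qBinom_pos hq hk).ne'

lemma eq_C_mul_X_pow_of_roots_eq_zero {P : ℝ[X]} (hs : P.roots.card = P.natDegree)
    (h : ∀ x ∈ P.roots, x = 0) : P = C P.leadingCoeff * X ^ P.natDegree := by
  conv_lhs => rw [← C_leadingCoeff_mul_prod_multiset_X_sub_C hs]
  rw [Multiset.eq_replicate_of_mem h, hs]
  simp

lemma preservesInterlacing_succ_of_trunc_eq_zero (hq : 0 < q)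
    (hH : NegSep (n + 1) q H) (hG : memR (n + 2) q G) (hG0 : G ≠ 0)
    (hV0 : trunc (n + 1) q G = 0) {z : ℂ} (hz : z ≠ 0) :
    ¬ aeval z (qHadamard (n + 1) q H (shiftUp (n + 1) q G)) = 0 := by
  have hc : ∀ k ≤ n + 1, G.coeff k = 0 := by
    intro k hk
    have := congrArg (fun P => P.coeff k) hV0
    simp only [coeff_zero, coeff_trunc hq (show k ≤ n + 1 + 1 by omega)] at this
    refine (mul_eq_zero.1 this).resolve_right ?_
    rw [show n + 1 + 1 - k = (n + 1 - k) + 1 by omega]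
    exact (div_pos (qNum_pos hq _) (qNum_pos hq _)).ne'
  have hGd : ∀ k, n + 2 < k → G.coeff k = 0 := fun k hk =>
    coeff_eq_zero_of_natDegree_lt (hG.1.trans_lt hk)
  have hS : shiftUp (n + 1) q G = C ((shiftUp (n + 1) q G).coeff (n + 1)) * X ^ (n + 1) := by
    ext k
    rw [coeff_C_mul_X_pow]
    split_ifs with h
    · rw [h]
    · rw [coeff_shiftUp]
      rcases Nat.lt_or_gt_of_ne h with h | h
      · rw [hc _ (by omega), zero_mul]
      · rw [hGd _ (by omega), zero_mul]
  rw [hS]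
  refine hH.aeval_qHadamard_monomial hq le_rfl ?_ hz
  rw [coeff_shiftUp]
  refine mul_ne_zero ?_ (div_pos (qNum_pos (inv_pos.2 hq) _) (qNum_pos hq _)).ne'
  intro h
  apply hG0
  ext k
  rw [coeff_zero]
  rcases lt_trichotomy k (n + 2) with h' | h' | h'
  · exact hc k (by omega)
  · rw [h']; exact h
  · exact hGd k h'

lemma preservesInterlacing_succ (hq : 0 < q) (hq1 : q ≤ 1) (hH : NegSep (n + 1) q H)
    (hSI : StrictlyInterlaces n q H) : PreservesInterlacing (n + 1) q H := by
  intro G hG hG0 z hz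
  by_cases hV0 : trunc (n + 1) q G = 0
  · refine ⟨by rw [hV0, qHadamard_comm _ _ H 0, qHadamard_zero_left, bez_zero_right], fun h => ?_⟩
    exact preservesInterlacing_succ_of_trunc_eq_zero hq hH hG hG0 hV0 hz h.1
  have hVR := memR_trunc hq hq1 hG
  have hgap := natDegree_shiftUp_le_natDegree_trunc hq (hG.card_roots hG0) hG.1 hV0
  have hQd := natDegree_shiftUp_le q hG.1
  have hbz := bez_shiftUp_trunc_nonpos hq hq1 hG0 (hG.card_roots hG0) hG.2.2.logSep hG.1
  have hcom := fun z hz => not_common_zero hq hq1 hG hG0 (z := z) hz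
  set V := trunc (n + 1) q G with hVdef
  set Q := shiftUp (n + 1) q G with hQdef
  obtain ⟨e, c, w, he, hw, hec, -, hQ⟩ := partial_fractions hV0 (hVR.card_roots hV0) hgap hbz
  set A := qHadamard (n + 1) q H V with hA
  set As : ℝ → ℝ[X] := fun s => qHadamard n q (V /ₘ (X - C s)) (trunc n q H) with hAs
  set Bs : ℝ → ℝ[X] := fun s => qHadamard n q (V /ₘ (X - C s)) (shiftUp n q H) with hBs
  have hVs : ∀ s ∈ V.roots.toFinset, memR n q (V /ₘ (X - C s)) :=
    fun s hs => hVR.divByMonic hV0 (Multiset.mem_toFinset.1 hs)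
  have hAB : ∀ s ∈ V.roots.toFinset, A = X * Bs s + C (-s) * As s := by
    intro s hs
    rw [hA, qHadamard_comm, hAs, hBs, ← qHadamard_X_sub_C_mul hq (hVs s hs).1,
      X_sub_C_mul_divByMonic (Multiset.mem_toFinset.1 hs)]
  have hHQ : qHadamard (n + 1) q H Q = C e * qHadamard (n + 1) q (X * V) H + C c * A
      + ∑ s ∈ V.roots.toFinset, C (w s) * As s := by
    rw [hA, qHadamard_comm _ _ H V, qHadamard_comm, hQ, qHadamard_add_left, add_mul,
      qHadamard_add_left, mul_assoc, qHadamard_C_mul_left, qHadamard_C_mul_left]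
    congr 1
    rw [qHadamard_sum_left]
    refine Finset.sum_congr rfl fun s hs => ?_
    rw [qHadamard_C_mul_left, qHadamard_eq_trunc hq (hVs s hs).1]
  have hterm : ∀ s ∈ V.roots.toFinset, bez z (As s) A < 0 := by
    intro s hs
    have hne : V /ₘ (X - C s) ≠ 0 := divByMonic_ne_zero (Multiset.mem_toFinset.1 hs)
    have := hSI _ (hVs s hs) hne z hz
    rwa [hAB s hs, bez_add_right, bez_C_mul_right, bez_self, mul_zero, add_zero]
  have hval : bez z (qHadamard (n + 1) q H Q) A = e * bez z (qHadamard (n + 1) q (X * V) H) A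
      + ∑ s ∈ V.roots.toFinset, w s * bez z (As s) A := by
    rw [hHQ, bez_add_left, bez_add_left, bez_C_mul_left, bez_C_mul_left, bez_self, bez_sum_left,
      mul_zero, add_zero]
    congr 1
    exact Finset.sum_congr rfl fun s _ => bez_C_mul_left _ _ _ _
  have hle : ∀ s ∈ V.roots.toFinset, w s * bez z (As s) A ≤ 0 := fun s hs =>
    mul_nonpos_of_nonneg_of_nonpos (hw s) (hterm s hs).le
  have hlt_e : e ≠ 0 → e * bez z (qHadamard (n + 1) q (X * V) H) A < 0 := by
    intro he0
    have hVd : V.natDegree ≤ n := by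
      by_contra hcon
      rw [coeff_eq_zero_of_natDegree_lt (by omega)] at hec
      exact mul_ne_zero he0 (leadingCoeff_ne_zero.2 hV0) hec.symm
    have hVn : memR n q V := ⟨hVd, hVR.2⟩
    have := hSI V hVn hV0 z hz
    rw [bez_antisymm] at this
    rw [hA, qHadamard_X_mul hq, qHadamard_comm (n + 1), qHadamard_eq_trunc hq hVd]
    exact mul_neg_of_neg_of_pos (lt_of_le_of_ne he he0) (by linarith)
  have hle_e : e * bez z (qHadamard (n + 1) q (X * V) H) A ≤ 0 := by
    rcases eq_or_ne e 0 with h | h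
    · rw [h, zero_mul]
    · exact (hlt_e h).le
  have hsum := Finset.sum_nonpos hle
  rw [hval]
  refine ⟨by linarith, fun ⟨hB0, hA0⟩ => ?_⟩
  have h0 : bez z (qHadamard (n + 1) q H Q) A = 0 := bez_eq_zero_of_common hB0 hA0
  rw [hval] at h0
  have he0 : e = 0 := by
    by_contra h
    have := hlt_e h
    linarith
  have hw0 : ∀ s ∈ V.roots.toFinset, w s = 0 := by
    intro s hs
    have := (Finset.sum_eq_zero_iff_of_nonpos hle).1 (by linarith) s hs
    exact (mul_eq_zero.1 this).resolve_right (hterm s hs).ne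
  have hQV : Q = C c * V := by
    rw [hQ, he0, Finset.sum_eq_zero fun s hs => by rw [hw0 s hs]; simp]
    simp
  have hroots : ∀ x ∈ V.roots, x = 0 := by
    intro x hx
    by_contra hx0
    have hVx : aeval (x : ℂ) V = 0 := aeval_ofReal_eq_zero_iff.2 ((mem_roots hV0).1 hx)
    exact hcom x (by exact_mod_cast hx0) ⟨by rw [hQV, map_mul, hVx, mul_zero], hVx⟩
  have hV := eq_C_mul_X_pow_of_roots_eq_zero (hVR.card_roots hV0) hroots
  rw [hA, hV] at hA0
  exact hH.aeval_qHadamard_monomial hq hVR.1 (leadingCoeff_ne_zero.2 hV0) hz hA0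

lemma preservesInterlacing_of_shiftUp_eq (hq : 0 < q) (hq1 : q ≤ 1) (hH : NegSep (n + 1) q H)
    {w : ℝ} (h : shiftUp n q H = C w * trunc n q H) : PreservesInterlacing (n + 1) q H := by
  have hc := @coeff_eq_of_shiftUp_eq q n H hq w h
  have hH0 := hH.coeff_pos (Nat.zero_le (n + 1))
  have hw : 0 < w := by
    have h1 := hH.coeff_pos (k := 1) (by omega)
    rw [hc (by omega), pow_one] at h1
    have h2 : 0 < qBinom (n + 1) 1 q := qBinom_pos hq (by omega)
    have h3 : 0 < (H.leadingCoeff * H.coeff 0) * w := by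
      by_contra hcon
      nlinarith [mul_nonneg (sub_nonneg.2 (not_lt.1 hcon)) h2.le]
    exact (mul_pos_iff_of_pos_left hH0).1 h3
  exact preservesInterlacing_of_coeff_eq hq hq1 (right_ne_zero_of_mul hH0.ne') hw
    fun k hk => hc hk

lemma interlacing_induction (hq : 0 < q) (hq1 : q ≤ 1) (n : ℕ) :
    (∀ H, NegSep n q H → PreservesInterlacing n q H) ∧
    (∀ F, NegSep (n + 1) q F → (∀ w, shiftUp n q F ≠ C w * trunc n q F) →
      StrictlyInterlaces n q F) := by
  induction n with
  | zero =>
    refine ⟨fun H hH => ?_, fun F hF => strictlyInterlaces_zero hq hq1 hF⟩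
    refine preservesInterlacing_of_coeff_eq hq hq1 (hH.coeff_ne_zero le_rfl) one_pos ?_
    intro k hk
    obtain rfl : k = 0 := by omega
    simp [qBinom_zero_right]
  | succ n ih =>
    refine ⟨fun H hH => ?_, fun F hF => strictlyInterlaces_succ hq hq1 ih.1 hF⟩
    by_cases h : ∃ w, shiftUp n q H = C w * trunc n q H
    · obtain ⟨w, hw⟩ := h
      exact preservesInterlacing_of_shiftUp_eq hq hq1 hH hw
    · exact preservesInterlacing_succ hq hq1 hH (ih.2 H hH (not_exists.1 h))

lemma NegSep.preservesInterlacing (hq : 0 < q) (hq1 : q ≤ 1) (hH : NegSep n q H) :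
    PreservesInterlacing n q H := (interlacing_induction hq hq1 n).1 H hH

end

section
variable {q : ℝ} {n : ℕ} {F G H P : ℝ[X]}

lemma coeff_comp_neg_X (P : ℝ[X]) (k : ℕ) : (P.comp (-X)).coeff k = (-1) ^ k * P.coeff k := by
  rw [show (-X : ℝ[X]) = C (-1) * X by simp, comp_C_mul_X_coeff, mul_comm]

lemma qHadamard_comp_neg_right (n : ℕ) (q : ℝ) (F G : ℝ[X]) :
    qHadamard n q F (G.comp (-X)) = (qHadamard n q F G).comp (-X) := by
  ext k
  simp only [coeff_comp_neg_X, coeff_qHadamard]; ring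

lemma natDegree_comp_neg_X (P : ℝ[X]) : (P.comp (-X)).natDegree = P.natDegree := by
  rw [natDegree_comp]; simp

lemma memR_comp_neg (h : memR n q G) : memR n q (G.comp (-X)) := by
  refine ⟨by rw [natDegree_comp_neg_X]; exact h.1, ?_, ?_⟩
  · rcases h.2.1 with h0 | h0
    · left; rw [h0, zero_comp]
    · right; rw [roots_comp_neg_X, Multiset.card_map, natDegree_comp_neg_X, h0]
  · rw [roots_comp_neg_X]; exact strictLogSep_roots_comp_neg h.2.2

lemma memRbar_comp_neg (h : memRbar n q G) : memRbar n q (G.comp (-X)) := by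
  refine ⟨by rw [natDegree_comp_neg_X]; exact h.1, ?_, ?_⟩
  · rcases h.2.1 with h0 | h0
    · left; rw [h0, zero_comp]
    · right; rw [roots_comp_neg_X, Multiset.card_map, natDegree_comp_neg_X, h0]
  · rw [roots_comp_neg_X]; exact logSep_roots_comp_neg h.2.2

lemma memR.succ (h : memR n q G) : memR (n + 1) q G := ⟨h.1.trans n.le_succ, h.2⟩

lemma memR.X_mul (h : memR n q G) : memR (n + 1) q (X * G) := by
  rcases eq_or_ne G 0 with rfl | hG
  · rw [mul_zero]; exact memR_zero
  have hr : (X * G).roots = 0 ::ₘ G.roots := by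
    rw [roots_mul (mul_ne_zero X_ne_zero hG), roots_X, Multiset.singleton_add]
  refine ⟨by rw [natDegree_X_mul hG]; exact Nat.succ_le_succ h.1, Or.inr ?_, ?_⟩
  · rw [hr, Multiset.card_cons, h.card_roots hG, natDegree_X_mul hG]
  · rw [hr]
    refine ⟨fun x hx hx0 h2 => ?_, fun x hx y hy hxy => ?_⟩
    · rw [Multiset.count_cons_of_ne hx0] at h2
      exact h.2.2.1 x ((Multiset.mem_cons.1 hx).resolve_left hx0) hx0 h2
    · have hx0 : x ≠ 0 := by rintro rfl; rcases hxy with h | h <;> linarith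
      have hy0 : y ≠ 0 := by rintro rfl; rcases hxy with h | h <;> linarith
      exact h.2.2.2 x ((Multiset.mem_cons.1 hx).resolve_left hx0) y
        ((Multiset.mem_cons.1 hy).resolve_left hy0) hxy

lemma NegSep.qHadamard_ne_zero (hF : NegSep n q F) (hq : 0 < q) (hG : memR n q G)
    (hG0 : G ≠ 0) : qHadamard n q F G ≠ 0 := by
  intro h
  have := congrArg (fun P => P.coeff G.natDegree) h
  simp only [coeff_qHadamard, coeff_zero] at this
  exact div_ne_zero (mul_ne_zero (hF.coeff_ne_zero hG.1) (leadingCoeff_ne_zero.2 hG0))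
    (qBinom_pos hq hG.1).ne' this

lemma NegSep.bez_dq_qHadamard (hF : NegSep (n + 1) q F) (hq : 0 < q) (hq1 : q ≤ 1)
    (hG : memR (n + 1) q G) (hG0 : G ≠ 0) {z : ℂ} (hz : z ≠ 0) :
    bez z (dq q (qHadamard (n + 1) q F G)) (qHadamard (n + 1) q F G) ≤ 0 ∧
    (aeval z (qHadamard (n + 1) q F G) = 0 →
      bez z (dq q (qHadamard (n + 1) q F G)) (qHadamard (n + 1) q F G) ≠ 0) := by
  obtain ⟨p, hp, hdq⟩ := inCone_dq hq hq1 hF.ne_zero hF.card hF.sep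
  have hσ := sum_weights hF.ne_zero hF.card hdq
  set P := qHadamard (n + 1) q F G with hP
  set A : ℝ → ℝ[X] := fun s => qHadamard n q (F /ₘ (X - C s)) (trunc n q G) with hA
  set B : ℝ → ℝ[X] := fun s => qHadamard n q (F /ₘ (X - C s)) (shiftUp n q G) with hB
  have hN : ∀ s ∈ F.roots.toFinset, NegSep n q (F /ₘ (X - C s)) :=
    fun s hs => hF.divByMonic (Multiset.mem_toFinset.1 hs)
  have hAB : ∀ s ∈ F.roots.toFinset, P = X * B s + C (-s) * A s := by
    intro s hs
    rw [hP, hA, hB, ← qHadamard_X_sub_C_mul hq (hN s hs).natDegree.le,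
      X_sub_C_mul_divByMonic (Multiset.mem_toFinset.1 hs)]
  have hdP : dq q P = ∑ s ∈ F.roots.toFinset, C (p s) * B s := by
    apply mul_left_cancel₀ (X_ne_zero (R := ℝ))
    rw [hP, X_mul_dq_qHadamard, hdq, qHadamard_X_mul hq, qHadamard_sum_left]
    congr 1
    exact Finset.sum_congr rfl fun s _ => qHadamard_C_mul_left _ _ _ _ _
  have hterm : ∀ s ∈ F.roots.toFinset, bez z (B s) P = -sqAbs z (B s) + (-s) * bez z (B s) (A s) := by
    intro s hs
    rw [hAB s hs, bez_add_right, bez_self_X_mul, bez_C_mul_right]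
  have hPI := fun s hs => (hN s hs).preservesInterlacing hq hq1 G hG hG0 z hz
  have hneg : ∀ s ∈ F.roots.toFinset, s < 0 := fun s hs => hF.neg s (Multiset.mem_toFinset.1 hs)
  have hle1 : ∀ s ∈ F.roots.toFinset, (-s) * bez z (B s) (A s) ≤ 0 := fun s hs =>
    mul_nonpos_of_nonneg_of_nonpos (by linarith [hneg s hs]) (hPI s hs).1
  have hle : ∀ s ∈ F.roots.toFinset, p s * bez z (B s) P ≤ 0 := fun s hs => by
    rw [hterm s hs]
    exact mul_nonpos_of_nonneg_of_nonpos (hp s) (by linarith [hle1 s hs, sqAbs_nonneg z (B s)])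
  have hval : bez z (dq q P) P = ∑ s ∈ F.roots.toFinset, p s * bez z (B s) P := by
    rw [hdP, bez_sum_left]
    exact Finset.sum_congr rfl fun s _ => bez_C_mul_left _ _ _ _
  rw [hval]
  refine ⟨Finset.sum_nonpos hle, fun hPz h0 => ?_⟩
  have hall := (Finset.sum_eq_zero_iff_of_nonpos hle).1 h0
  obtain ⟨s, hs, hps⟩ : ∃ s ∈ F.roots.toFinset, p s ≠ 0 := by
    by_contra! hcon
    rw [Finset.sum_eq_zero hcon, hF.natDegree] at hσ
    exact (qNum_pos (inv_pos.2 hq) n).ne hσ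
  have h1 := (mul_eq_zero.1 (hall s hs)).resolve_left hps
  rw [hterm s hs] at h1
  have h2 : aeval z (B s) = 0 :=
    sqAbs_eq_zero.1 (by linarith [hle1 s hs, sqAbs_nonneg z (B s)])
  refine (hPI s hs).2 ⟨h2, ?_⟩
  rw [hAB s hs, map_add, map_mul, h2, mul_zero, zero_add, map_mul, aeval_C] at hPz
  refine (mul_eq_zero.1 hPz).resolve_left ?_
  simpa using (hneg s hs).ne

/-- If `P(z/q)` and `z P(z)` strictly interlace, positive zeros are strictly separated. -/
lemma lt_mul_of_bez_neg (hq : 0 < q) (hq1 : q ≤ 1) (hP : P ≠ 0)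
    (hb : ∀ x : ℝ, x ≠ 0 → bez x (dq q P) P ≤ 0)
    (hb0 : ∀ x : ℝ, x ≠ 0 → P.eval x = 0 → bez x (dq q P) P ≠ 0) {u y : ℝ} (hu : 0 < u)
    (huy : u < y) (hPu : P.eval u = 0) (hPy : P.eval y = 0) : u < q * y := by
  rcases hq1.eq_or_lt with rfl | hq1'
  · rwa [one_mul]
  set E := P.comp (C q⁻¹ * X) with hE
  have hκ : 0 < (1 - q) / q := div_pos (by linarith) hq
  have hbE : ∀ x : ℝ, x ≠ 0 → bez x E (X * P) < 0 := by
    intro x hx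
    have hx2 : 0 < Complex.normSq (x : ℂ) := Complex.normSq_pos.2 (by exact_mod_cast hx)
    rw [hE, comp_inv_mul hq, bez_add_left, bez_C_mul_left, bez_X_mul_X_mul, bez_self_X_mul]
    have h1 := hb x hx
    by_cases hPx : P.eval x = 0
    · have := lt_of_le_of_ne h1 (hb0 x hx hPx)
      have := mul_neg_of_pos_of_neg hκ (mul_neg_of_pos_of_neg hx2 this)
      linarith [sqAbs_nonneg x P]
    · have := sqAbs_pos (fun h => hPx (aeval_ofReal_eq_zero_iff.1 h))
      have := mul_nonpos_of_nonneg_of_nonpos hκ.le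
        (mul_nonpos_of_nonneg_of_nonpos hx2.le h1)
      linarith
  have hEr : ∀ s : ℝ, P.eval s = 0 → E.eval (q * s) = 0 := by
    intro s hs
    simp [hE, hq.ne', hs]
  have hcom : ∀ s : ℝ, 0 < s → P.eval s = 0 → P.eval (q * s) ≠ 0 := by
    intro s hs h1 h2
    have hx : q * s ≠ 0 := (mul_pos hq hs).ne'
    refine (hbE (q * s) hx).ne (bez_eq_zero_of_common ?_ ?_)
    · exact aeval_ofReal_eq_zero_iff.2 (hEr s h1)
    · exact aeval_ofReal_eq_zero_iff.2 (by simp [h2])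
  have hbetween : ∀ s t : ℝ, 0 < s → s < t → P.eval s = 0 → P.eval t = 0 →
      ∃ r, q * s < r ∧ r < q * t ∧ P.eval r = 0 := by
    intro s t hs hst hPs hPt
    by_contra! hcon
    have hqs := mul_pos hq hs
    obtain ⟨x, hx1, -, hx⟩ := exists_bez_eq_zero (E := E) (G := X * P)
      (mul_lt_mul_of_pos_left hst hq) (hEr s hPs) (hEr t hPt) (by
        intro x hx1 hx2
        have hx0 : 0 < x := by linarith
        rw [eval_mul, eval_X]
        refine mul_ne_zero hx0.ne' ?_
        rcases hx1.eq_or_lt with h | h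
        · rw [← h]; exact hcom s hs hPs
        rcases hx2.eq_or_lt with h' | h'
        · rw [h']; exact hcom t (hs.trans hst) hPt
        exact hcon x h h')
    exact (hbE x (by linarith)).ne hx
  by_contra! hcon
  let S := P.roots.toFinset.filter fun y => ∃ u, 0 < u ∧ u < y ∧ q * y ≤ u ∧ P.eval u = 0
  have hS : ∀ {y}, y ∈ S ↔ P.eval y = 0 ∧ ∃ u, 0 < u ∧ u < y ∧ q * y ≤ u ∧ P.eval u = 0 := by
    intro y
    simp [S, hP]
  obtain ⟨t, ht, hmin⟩ := S.exists_min_image id ⟨y, hS.2 ⟨hPy, u, hu, huy, hcon, hPu⟩⟩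
  obtain ⟨hPt, s, hs, hst, hqt, hPs⟩ := hS.1 ht
  obtain ⟨r, hr1, hr2, hPr⟩ := hbetween s t hs hst hPs hPt
  have := hmin s (hS.2 ⟨hPs, r, (mul_pos hq hs).trans hr1, by linarith, hr1.le, hPr⟩)
  simp only [id] at this
  linarith

lemma NegSep.memR_qHadamard (hF : NegSep (n + 1) q F) (hq : 0 < q) (hq1 : q ≤ 1)
    (hG : memR (n + 1) q G) : memR (n + 1) q (qHadamard (n + 1) q F G) := by
  rcases eq_or_ne G 0 with rfl | hG0
  · rw [qHadamard_comm, qHadamard_zero_left]; exact memR_zero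
  have hP := hF.qHadamard_ne_zero hq hG hG0
  have hsep : ∀ G, memR (n + 1) q G → G ≠ 0 → ∀ s t, 0 < s → s < t →
      (qHadamard (n + 1) q F G).eval s = 0 → (qHadamard (n + 1) q F G).eval t = 0 → s < q * t := by
    intro G hG hG0 s t hs hst hPs hPt
    have hb := fun (x : ℝ) (hx : x ≠ 0) =>
      hF.bez_dq_qHadamard hq hq1 hG hG0 (z := x) (by exact_mod_cast hx)
    exact lt_mul_of_bez_neg hq hq1 (hF.qHadamard_ne_zero hq hG hG0) (fun x hx => (hb x hx).1)
      (fun x hx h => (hb x hx).2 (aeval_ofReal_eq_zero_iff.2 h)) hs hst hPs hPt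
  refine ⟨natDegree_qHadamard_le _ _ _ _, Or.inr (card_roots_of_forall_nonreal hP ?_),
    (strictLogSep_roots_iff hP).2 ⟨?_, hsep G hG hG0, ?_⟩⟩
  · intro z hz h
    refine (hF.bez_dq_qHadamard hq hq1 hG hG0 (z := z) (by rintro rfl; simp at hz)).2 h ?_
    rw [bez_antisymm, neg_eq_zero, bez_eq_zero_of_nonreal hz h]
  · intro s hs h1 h2
    refine absurd ?_ ((hF.bez_dq_qHadamard hq hq1 hG hG0 (z := s) (by exact_mod_cast hs)).2
      (aeval_ofReal_eq_zero_iff.2 h1))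
    rw [bez_ofReal, h1, h2]; ring
  · rw [← qHadamard_comp_neg_right]
    exact hsep _ (memR_comp_neg hG) (by rwa [Ne, comp_neg_X_eq_zero_iff])

lemma memR_qHadamard_of_memNbar (hq : 0 < q) (hq1 : q ≤ 1) : ∀ {F G : ℝ[X]}, memNbar n q F →
    memR n q G → memR n q (qHadamard n q F G) := by
  induction n with
  | zero =>
    intro F G _ _
    have h := natDegree_qHadamard_le 0 q F G
    rw [eq_C_of_natDegree_le_zero h]
    exact ⟨by simp, Or.inr (by simp), by simpa using strictLogSep_zero⟩
  | succ n ih =>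
    intro F G ⟨⟨hd, hr, hsep⟩, hneg⟩ hG
    rcases eq_or_ne F 0 with rfl | hF0
    · rw [qHadamard_zero_left]; exact memR_zero
    have hs := hr.resolve_left hF0
    by_cases h0 : F.coeff 0 = 0
    · obtain ⟨H, rfl⟩ := X_dvd_iff.2 h0
      have hH : H ≠ 0 := right_ne_zero_of_mul hF0
      have hroots : (X * H).roots = 0 ::ₘ H.roots := by
        rw [roots_mul hF0, roots_X, Multiset.singleton_add]
      rw [qHadamard_X_mul hq]
      rw [natDegree_X_mul hH] at hd hs
      rw [hroots, Multiset.card_cons] at hs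
      refine (ih ⟨⟨by omega, Or.inr (by omega), hsep.of_le ?_⟩, fun x hx => hneg x ?_⟩
        (memR_shiftUp hq hq1 hG)).X_mul
      · rw [hroots]; exact Multiset.le_cons_self _ _
      · rw [hroots]; exact Multiset.mem_cons_of_mem hx
    rcases hd.lt_or_eq with h | h
    · rw [qHadamard_eq_trunc hq (by omega)]
      exact (ih ⟨⟨by omega, hr, hsep⟩, hneg⟩ (memR_trunc hq hq1 hG)).succ
    · refine NegSep.memR_qHadamard ⟨hF0, hs, h, fun x hx => ?_, hsep⟩ hq hq1 hG
      refine lt_of_le_of_ne (hneg x hx) ?_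
      rintro rfl
      rw [mem_roots hF0, IsRoot.def, ← coeff_zero_eq_eval_zero] at hx
      exact h0 hx

end

section
variable {q : ℝ} {n : ℕ} {F G H P : ℝ[X]}

/-! ### Sign patterns of the coefficients -/

lemma coeff_ne_zero_of_nonneg {k : ℕ} : ∀ {P : ℝ[X]}, P.roots.card = P.natDegree →
    P.coeff 0 ≠ 0 → (∀ i, 0 ≤ P.coeff i * P.coeff (i + 2)) → k ≤ P.natDegree →
    P.coeff k ≠ 0 := by
  induction k with
  | zero => intro P _ h0 _ _; exact h0
  | succ k ih =>
    intro P hs h0 hc hk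
    have h1 := two_mul_coeff_zero_mul_coeff_two_lt hs h0 (by omega)
    have h2 := hc 0
    have h3 : P.coeff 1 ≠ 0 := by
      rintro h; rw [h] at h1; norm_num at h1 h2; linarith
    have hd : (derivative P).natDegree = P.natDegree - 1 := natDegree_derivative P
    have := ih (card_roots_derivative hs) (by simpa [coeff_derivative] using h3) (fun i => by
      simp only [coeff_derivative]
      have h4 := hc (i + 1)
      have h5 : (0 : ℝ) ≤ ((i : ℝ) + 1) * (((i + 2 : ℕ) : ℝ) + 1) := by positivity
      rw [show i + 1 + 2 = i + 2 + 1 by ring] at h4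
      calc (0 : ℝ) ≤ (P.coeff (i + 1) * P.coeff (i + 2 + 1))
            * (((i : ℝ) + 1) * (((i + 2 : ℕ) : ℝ) + 1)) := mul_nonneg h4 h5
        _ = _ := by ring) (by omega)
    rw [coeff_derivative] at this
    exact left_ne_zero_of_mul this

lemma onlyNonposRoots_of_coeff_pos (hs : P.roots.card = P.natDegree) (h0 : P.coeff 0 ≠ 0)
    (hc : ∀ i, 0 ≤ P.coeff i * P.coeff (i + 2)) (h1 : 0 ≤ P.coeff 0 * P.coeff 1) :
    OnlyNonposRoots P := by
  have hne := fun k => @coeff_ne_zero_of_nonneg k P hs h0 hc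
  have hpos : ∀ k, (k ≤ P.natDegree → 0 < P.coeff 0 * P.coeff k) ∧
      (k + 1 ≤ P.natDegree → 0 < P.coeff 0 * P.coeff (k + 1)) := by
    intro k
    induction k with
    | zero =>
      exact ⟨fun _ => mul_self_pos.2 h0,
        fun hk => lt_of_le_of_ne h1 (mul_ne_zero h0 (hne 1 hk)).symm⟩
    | succ k ih =>
      refine ⟨ih.2, fun hk => ?_⟩
      have h2 := ih.1 (by omega)
      have h3 := lt_of_le_of_ne (hc k) (mul_ne_zero (hne k (by omega)) (hne (k + 2) hk)).symm
      have h4 : 0 < (P.coeff 0 * P.coeff (k + 2)) * P.coeff k ^ 2 := by nlinarith [mul_pos h2 h3]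
      exact pos_of_mul_pos_left h4 (sq_nonneg _)
  intro x hx
  by_contra hx0
  have hP : P ≠ 0 := by rintro rfl; simp at h0
  exact eval_ne_zero_of_coeff_pos le_rfl (fun k hk => (hpos k).1 hk) (not_le.1 hx0).le
    ((mem_roots hP).1 hx)

lemma onlyNonposRoots_X_mul (hH : H ≠ 0) (h : OnlyNonposRoots H) : OnlyNonposRoots (X * H) := by
  intro x hx
  rw [roots_mul (mul_ne_zero X_ne_zero hH), roots_X, Multiset.singleton_add,
    Multiset.mem_cons] at hx
  rcases hx with rfl | hx
  · exact le_rfl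
  · exact h x hx

lemma onlyNonposRoots_or {d : ℕ} : ∀ {F : ℝ[X]}, F.natDegree = d → F ≠ 0 →
    F.roots.card = F.natDegree → (∀ i, 0 ≤ F.coeff i * F.coeff (i + 2)) →
    OnlyNonposRoots F ∨ OnlyNonposRoots (F.comp (-X)) := by
  induction d with
  | zero =>
    intro F hd _ hs _
    left
    intro x hx
    rw [hd, Multiset.card_eq_zero] at hs
    simp [hs] at hx
  | succ d ih =>
    intro F hd hF hs hc
    by_cases h0 : F.coeff 0 = 0
    · obtain ⟨H, rfl⟩ := X_dvd_iff.2 h0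
      have hH : H ≠ 0 := right_ne_zero_of_mul hF
      rw [natDegree_X_mul hH] at hd hs
      rw [roots_mul hF, roots_X, Multiset.singleton_add, Multiset.card_cons] at hs
      refine (ih (by omega) hH (by omega) fun i => ?_).imp (onlyNonposRoots_X_mul hH) fun h => ?_
      · simpa using hc (i + 1)
      · have hH' : H.comp (-X) ≠ 0 := by rwa [Ne, comp_neg_X_eq_zero_iff]
        have := onlyNonposRoots_X_mul hH' h
        rw [mul_comp, X_comp, neg_mul]
        intro x hx
        rw [roots_neg] at hx
        exact this x hx
    · rcases le_total 0 (F.coeff 0 * F.coeff 1) with h1 | h1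
      · exact Or.inl (onlyNonposRoots_of_coeff_pos hs h0 hc h1)
      · right
        refine onlyNonposRoots_of_coeff_pos ?_ ?_ (fun i => ?_) ?_
        · rw [roots_comp_neg_X, Multiset.card_map, natDegree_comp_neg_X, hs]
        · simpa [coeff_comp_neg_X] using h0
        · rw [coeff_comp_neg_X, coeff_comp_neg_X, pow_add]
          have := mul_nonneg (hc i) (sq_nonneg ((-1 : ℝ) ^ i))
          nlinarith
        · rw [coeff_comp_neg_X, coeff_comp_neg_X]; nlinarith

lemma memR_one_sub_X_sq : memR 2 q (1 - X ^ 2) := by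
  have h : (1 - X ^ 2 : ℝ[X]) = C (-1) * ((X - C 1) * (X - C (-1))) := by
    simp only [C_neg, C_1]; ring
  have hne : ((X - C 1) * (X - C (-1)) : ℝ[X]) ≠ 0 :=
    mul_ne_zero (X_sub_C_ne_zero _) (X_sub_C_ne_zero _)
  have hr : (1 - X ^ 2 : ℝ[X]).roots = {1, -1} := by
    rw [h, roots_C_mul _ (by norm_num), roots_mul hne, roots_X_sub_C, roots_X_sub_C]; rfl
  have hd : (1 - X ^ 2 : ℝ[X]).natDegree = 2 := by
    rw [h, natDegree_C_mul (by norm_num), natDegree_mul (X_sub_C_ne_zero _) (X_sub_C_ne_zero _),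
      natDegree_X_sub_C, natDegree_X_sub_C]
  refine ⟨hd.le, Or.inr (by rw [hr, hd]; rfl), ?_⟩
  rw [hr]
  constructor
  · intro x hx _ h2
    have hnd : ({1, -1} : Multiset ℝ).Nodup := by
      rw [Multiset.insert_eq_cons, Multiset.nodup_cons]
      exact ⟨by norm_num, Multiset.nodup_singleton _⟩
    have := Multiset.nodup_iff_count_le_one.1 hnd x
    omega
  · intro x hx y hy hxy
    simp only [Multiset.insert_eq_cons, Multiset.mem_cons, Multiset.mem_singleton] at hx hy
    rcases hx with rfl | rfl <;> rcases hy with rfl | rfl <;> norm_num at hxy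

lemma memR_X_pow_mul (hG : memR n q G) (k : ℕ) : memR (n + k) q (X ^ k * G) := by
  induction k with
  | zero => simpa using hG
  | succ k ih => rw [pow_succ', mul_assoc]; exact ih.X_mul

lemma coeff_mul_coeff_nonneg (hq : 0 < q)
    (h : ∀ G, memR n q G → memR n q (qHadamard n q F G)) {k : ℕ} (hk : k + 2 ≤ n) :
    0 ≤ F.coeff k * F.coeff (k + 2) := by
  by_contra! hcon
  have hG : memR n q (X ^ k * (1 - X ^ 2)) := by
    have := memR_X_pow_mul (memR_one_sub_X_sq (q := q)) k
    exact ⟨this.1.trans (by omega), this.2⟩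
  have hP := h _ hG
  have hb := qBinom_pos hq (show k ≤ n by omega)
  have hb2 := qBinom_pos hq hk
  obtain ⟨a, ha⟩ : ∃ a, a = F.coeff k / qBinom n k q := ⟨_, rfl⟩
  obtain ⟨b, hb'⟩ : ∃ b, b = F.coeff (k + 2) / qBinom n (k + 2) q := ⟨_, rfl⟩
  have hab : a * b < 0 := by
    rw [ha, hb', div_mul_div_comm]
    exact div_neg_of_neg_of_pos hcon (mul_pos hb hb2)
  have hPe : qHadamard n q F (X ^ k * (1 - X ^ 2)) = X ^ k * (C a - C b * X ^ 2) := by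
    rw [show (X ^ k * (1 - X ^ 2) : ℝ[X]) = X ^ k - X ^ (k + 2) by ring,
      show X ^ k * (C a - C b * X ^ 2) = C a * X ^ k - C b * X ^ (k + 2) by ring]
    ext i
    simp only [coeff_qHadamard, coeff_sub, coeff_X_pow, coeff_C_mul, ha, hb']
    split_ifs with h1 h2 h2
    · omega
    · subst h1; ring
    · subst h2; ring
    · simp
  have hb0 : b ≠ 0 := right_ne_zero_of_mul hab.ne
  have hbq : 0 < -(a / b) := neg_pos.2 (div_neg_iff.2 (mul_neg_iff.1 hab))
  have hr2 : ((Real.sqrt (-(a / b)) : ℝ) : ℂ) ^ 2 = -(a / b) := by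
    rw [← Complex.ofReal_pow, Real.sq_sqrt hbq.le]; push_cast; ring
  have hrpos := Real.sqrt_pos.2 hbq
  have hP0 : qHadamard n q F (X ^ k * (1 - X ^ 2)) ≠ 0 := by
    rw [hPe]
    refine mul_ne_zero (pow_ne_zero _ X_ne_zero) fun h0 => hb0 ?_
    have := congrArg (fun P => P.coeff 2) h0
    simpa [coeff_C] using this
  refine aeval_ne_zero_of_card_roots hP0 (hP.card_roots hP0)
    (z := (Real.sqrt (-(a / b)) : ℝ) * Complex.I) (by simpa using hrpos.ne') ?_
  rw [hPe, map_mul]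
  simp only [map_sub, map_mul, map_pow, aeval_X, aeval_C, Complex.coe_algebraMap, mul_pow, hr2,
    Complex.I_sq]
  have : (b : ℂ) ≠ 0 := by exact_mod_cast hb0
  field_simp
  ring

end

section
variable {q : ℝ} {n : ℕ} {F G H P : ℝ[X]}

/-! ### Closedness of `𝓡̄_n(q)` -/

lemma exists_roots_eq_map {s : Multiset ℝ} {d : ℕ} (hs : s.card = d) :
    ∃ x : Fin d → ℝ, s = (Finset.univ : Finset (Fin d)).val.map x := by
  subst hs
  refine ⟨fun i => s.toList.get (i.cast (by simp)), ?_⟩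
  conv_lhs => rw [← Multiset.coe_toList s]
  rw [Fin.univ_val_map]
  congr 1
  refine List.ext_get (by simp) fun i h1 h2 => ?_
  simp

lemma two_le_count_map {d : ℕ} {x : Fin d → ℝ} {a : ℝ} :
    2 ≤ ((Finset.univ : Finset (Fin d)).val.map x).count a ↔ ∃ i j, i ≠ j ∧ x i = a ∧ x j = a := by
  rw [Multiset.count_map, ← Finset.filter_val, Finset.card_val, Nat.succ_le_iff,
    Finset.one_lt_card]
  simp only [Finset.mem_filter, Finset.mem_univ, true_and]
  constructor
  · rintro ⟨i, hi, j, hj, hij⟩; exact ⟨i, j, hij, hi.symm, hj.symm⟩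
  · rintro ⟨i, j, hij, hi, hj⟩; exact ⟨i, hi.symm, j, hj.symm, hij⟩

/-- The closed form of logarithmic separation for a tuple. -/
def TupleSep (q : ℝ) {d : ℕ} (x : Fin d → ℝ) : Prop :=
  ∀ i j, i ≠ j → x i * x j ≤ 0 ∨ |x i| ≤ q * |x j| ∨ |x j| ≤ q * |x i|

lemma isClosed_tupleSep (q : ℝ) (d : ℕ) : IsClosed {x : Fin d → ℝ | TupleSep q x} := by
  have key (i j : Fin d) :
      IsClosed {x : Fin d → ℝ | x i * x j ≤ 0 ∨ |x i| ≤ q * |x j| ∨ |x j| ≤ q * |x i|} := by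
    have h1 : IsClosed {x : Fin d → ℝ | x i * x j ≤ 0} := isClosed_le (by fun_prop) (by fun_prop)
    have h2 : IsClosed {x : Fin d → ℝ | |x i| ≤ q * |x j|} :=
      isClosed_le (by fun_prop) (by fun_prop)
    have h3 : IsClosed {x : Fin d → ℝ | |x j| ≤ q * |x i|} :=
      isClosed_le (by fun_prop) (by fun_prop)
    exact h1.union (h2.union h3)
  simp only [TupleSep, Set.ofPred_forall]
  exact isClosed_iInter fun i => isClosed_iInter fun j => isClosed_iInter fun _ => key i j

lemma abs_le_mul_abs_of_lt {s : Multiset ℝ} (h : LogSep q s) {x y : ℝ} (hx : x ∈ s) (hy : y ∈ s)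
    (hxy : 0 < x * y) (hlt : x < y) : |x| ≤ q * |y| ∨ |y| ≤ q * |x| := by
  rcases lt_or_ge 0 x with h0 | h0
  · left
    have hy0 : 0 < y := h0.trans hlt
    rw [abs_of_pos h0, abs_of_pos hy0, ← div_le_iff₀ hy0]
    exact h.2 x hx y hy (Or.inr ⟨h0, hlt⟩)
  · right
    have hx0 : x < 0 := lt_of_le_of_ne h0 (left_ne_zero_of_mul hxy.ne')
    have hy0 : y < 0 := by by_contra hc; nlinarith
    rw [abs_of_neg hx0, abs_of_neg hy0, ← div_le_iff₀ (by linarith), neg_div_neg_eq]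
    exact h.2 y hy x hx (Or.inl ⟨hlt, hy0⟩)

lemma StrictLogSep.tupleSep (hq1 : q ≤ 1) {d : ℕ} {x : Fin d → ℝ}
    (h : StrictLogSep q ((Finset.univ : Finset (Fin d)).val.map x)) : TupleSep q x := by
  intro i j hij
  refine or_iff_not_imp_left.2 fun h0 => ?_
  rw [not_le] at h0
  have hi : x i ∈ (Finset.univ : Finset (Fin d)).val.map x := Multiset.mem_map_of_mem x (Finset.mem_univ i)
  have hj : x j ∈ (Finset.univ : Finset (Fin d)).val.map x := Multiset.mem_map_of_mem x (Finset.mem_univ j)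
  rcases lt_trichotomy (x i) (x j) with hlt | heq | hlt
  · exact abs_le_mul_abs_of_lt h.logSep hi hj h0 hlt
  · have := h.1 (x i) hi (left_ne_zero_of_mul h0.ne') (two_le_count_map.2 ⟨i, j, hij, rfl, heq.symm⟩)
    linarith
  · exact (abs_le_mul_abs_of_lt h.logSep hj hi (by rwa [mul_comm]) hlt).symm

lemma TupleSep.logSep (hq1 : q ≤ 1) {d : ℕ} {x : Fin d → ℝ} (h : TupleSep q x) :
    LogSep q ((Finset.univ : Finset (Fin d)).val.map x) := by
  constructor
  · intro a _ ha0 h2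
    obtain ⟨i, j, hij, rfl, hj⟩ := two_le_count_map.1 h2
    have hpos := abs_pos.2 ha0
    rcases h i j hij with h1 | h1
    · rw [hj] at h1
      exact absurd h1 (not_le.2 (mul_self_pos.2 ha0))
    · rw [hj, or_self] at h1
      by_contra hc
      nlinarith
  · intro a ha b hb hab
    obtain ⟨i, -, rfl⟩ := Multiset.mem_map.1 ha
    obtain ⟨j, -, rfl⟩ := Multiset.mem_map.1 hb
    have hij : i ≠ j := by rintro rfl; rcases hab with h | h <;> linarith
    have key : ∀ {u v : ℝ}, 0 < u → u < v → (u ≤ q * v ∨ v ≤ q * u) → u / v ≤ q := by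
      intro u v hu huv h'
      rw [div_le_iff₀ (hu.trans huv)]
      rcases h' with h' | h'
      · exact h'
      · nlinarith
    rcases hab with ⟨h1, h2⟩ | ⟨h1, h2⟩
    · have h3 := (h i j hij).resolve_left (not_le.2 (mul_pos_of_neg_of_neg h2 (h1.trans h2)))
      rw [abs_of_neg h2, abs_of_neg (h1.trans h2)] at h3
      rw [← neg_div_neg_eq]
      exact key (by linarith) (by linarith) h3
    · have h3 := (h i j hij).resolve_left (not_le.2 (mul_pos h1 (h1.trans h2)))
      rw [abs_of_pos h1, abs_of_pos (h1.trans h2)] at h3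
      exact key h1 h2 h3

lemma abs_root_le {x : ℝ} (hP : P ≠ 0) (hx : P.eval x = 0) :
    |x| ≤ (∑ k ∈ Finset.range P.natDegree, |P.coeff k|) / |P.leadingCoeff| + 1 := by
  have h := NNReal.coe_lt_coe.2 (IsRoot.norm_lt_cauchyBound hP hx)
  have h2 : ((cauchyBound P : NNReal) : ℝ)
      ≤ (∑ k ∈ Finset.range P.natDegree, |P.coeff k|) / |P.leadingCoeff| + 1 := by
    have : cauchyBound P ≤ (∑ k ∈ Finset.range P.natDegree, ‖P.coeff k‖₊) / ‖P.leadingCoeff‖₊ + 1 := by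
      unfold cauchyBound
      gcongr
      exact Finset.sup_le fun k hk =>
        Finset.single_le_sum (f := fun k => ‖P.coeff k‖₊) (fun _ _ => zero_le) hk
    have := NNReal.coe_le_coe.2 this
    push_cast at this
    simpa [Real.norm_eq_abs] using this
  rw [coe_nnnorm, Real.norm_eq_abs] at h
  exact h.le.trans h2

lemma memRbar_of_tendsto (hq1 : q ≤ 1) (hFn : F.natDegree ≤ n) (hF : F ≠ 0) {P : ℕ → ℝ[X]}
    (hP0 : ∀ i, P i ≠ 0) (hP : ∀ i, memR n q (P i)) (hd : ∀ i, (P i).natDegree = F.natDegree)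
    (hlim : ∀ k, Tendsto (fun i => (P i).coeff k) atTop (nhds (F.coeff k))) : memRbar n q F := by
  have hcard : ∀ i, (P i).roots.card = F.natDegree := fun i => by
    rw [(hP i).card_roots (hP0 i), hd]
  choose x hx using fun i => exists_roots_eq_map (hcard i)
  have hlc : F.leadingCoeff ≠ 0 := leadingCoeff_ne_zero.2 hF
  have hlclim : Tendsto (fun i => (P i).leadingCoeff) atTop (nhds F.leadingCoeff) := by
    simpa only [leadingCoeff, hd] using hlim F.natDegree
  have hbd : Tendsto (fun i => (∑ k ∈ Finset.range F.natDegree, |(P i).coeff k|)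
      / |(P i).leadingCoeff| + 1) atTop (nhds ((∑ k ∈ Finset.range F.natDegree, |F.coeff k|)
      / |F.leadingCoeff| + 1)) :=
    ((tendsto_finsetSum _ fun k _ => (hlim k).abs).div hlclim.abs (abs_ne_zero.2 hlc)).add_const 1
  obtain ⟨M, hM⟩ := hbd.bddAbove_range
  have hxM : ∀ i j, |x i j| ≤ M := by
    intro i j
    have hmem : x i j ∈ (P i).roots := by
      rw [hx i]; exact Multiset.mem_map_of_mem _ (Finset.mem_univ j)
    refine (abs_root_le (hP0 i) ((mem_roots (hP0 i)).1 hmem)).trans (hM ⟨i, ?_⟩)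
    simp only [hd]
  have hM0 : 0 ≤ M := by
    have := hM ⟨0, rfl⟩
    refine le_trans ?_ this
    positivity
  obtain ⟨a, -, φ, hφ, ha⟩ := tendsto_subseq_of_bounded
    (Metric.isBounded_closedBall (x := (0 : Fin F.natDegree → ℝ)) (r := M)) (x := x) (fun i => by
      rw [mem_closedBall_zero_iff, pi_norm_le_iff_of_nonneg hM0]
      exact fun j => hxM i j)
  have hsep : TupleSep q a := by
    refine (isClosed_tupleSep q _).mem_of_tendsto ha (Eventually.of_forall fun i => ?_)
    have := (hP (φ i)).2.2
    rw [hx] at this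
    exact this.tupleSep hq1
  have hprod : F = C F.leadingCoeff * ∏ j, (X - C (a j)) := by
    refine Polynomial.funext fun t => ?_
    have h1 : Tendsto (fun i => (P (φ i)).eval t) atTop (nhds (F.eval t)) := by
      have : ∀ i, (P (φ i)).eval t
          = ∑ k ∈ Finset.range (F.natDegree + 1), (P (φ i)).coeff k * t ^ k := fun i =>
        eval_eq_sum_range' (by rw [hd]; exact Nat.lt_succ_self _) t
      simp only [this, eval_eq_sum_range]
      exact tendsto_finsetSum _ fun k _ => ((hlim k).comp hφ.tendsto_atTop).mul_const _
    have h2 : ∀ i, (P (φ i)).eval t = (P (φ i)).leadingCoeff * ∏ j, (t - x (φ i) j) := by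
      intro i
      have h3 := C_leadingCoeff_mul_prod_multiset_X_sub_C ((hP (φ i)).card_roots (hP0 (φ i)))
      conv_lhs => rw [← h3, hx, Multiset.map_map]
      rw [eval_mul, eval_C]
      congr 1
      change eval t (∏ j, (X - C (x (φ i) j))) = _
      rw [eval_prod]
      simp
    simp only [h2] at h1
    have h4 : Tendsto (fun i => (P (φ i)).leadingCoeff * ∏ j, (t - x (φ i) j)) atTop
        (nhds (F.leadingCoeff * ∏ j, (t - a j))) :=
      (hlclim.comp hφ.tendsto_atTop).mul (tendsto_finsetProd _ fun j _ =>
        tendsto_const_nhds.sub ((tendsto_pi_nhds.1 ha) j))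
    rw [tendsto_nhds_unique h1 h4, eval_mul, eval_C, eval_prod]
    simp
  have hroots : F.roots = (Finset.univ : Finset (Fin F.natDegree)).val.map a := by
    conv_lhs => rw [hprod, roots_C_mul _ hlc]
    have := roots_multiset_prod_X_sub_C ((Finset.univ : Finset (Fin F.natDegree)).val.map a)
    rwa [Multiset.map_map] at this
  refine ⟨hFn, Or.inr ?_, ?_⟩
  · rw [hroots]; simp
  · rw [hroots]; exact hsep.logSep hq1

/-! ### The generating polynomials of the `q`-binomial coefficients -/

lemma continuous_qBinom (n k : ℕ) : Continuous (qBinom n k) := by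
  induction n generalizing k with
  | zero =>
    rcases k with _ | k
    · simp only [funext (qBinom_zero_right 0)]; exact continuous_const
    · simp only [funext fun q => qBinom_eq_zero q k.succ_pos]; exact continuous_const
  | succ n ih =>
    rcases k with _ | k
    · simp only [funext (qBinom_zero_right (n + 1))]; exact continuous_const
    · simp only [funext (qBinom_succ_succ n k)]
      exact (ih (k + 1)).add ((continuous_pow n).mul (ih k))

lemma memR_Rpoly {p : ℝ} (hp : 0 < p) (hpq : p < q) (hq1 : q ≤ 1) : memR n q (Rpoly n p) := by
  have hfac : Rpoly n p = C (∏ j ∈ Finset.range n, p ^ j)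
      * ∏ j ∈ Finset.range n, (X - C (-(p ^ j)⁻¹)) := by
    rw [Rpoly, map_prod, ← Finset.prod_mul_distrib]
    refine Finset.prod_congr rfl fun j _ => ?_
    have : p ^ j ≠ 0 := (pow_pos hp j).ne'
    rw [C_neg, sub_neg_eq_add, mul_add, ← C_mul, mul_inv_cancel₀ this, C_1, add_comm]
  have hc : (∏ j ∈ Finset.range n, p ^ j) ≠ 0 :=
    Finset.prod_ne_zero_iff.2 fun j _ => (pow_pos hp j).ne'
  have hroots : (Rpoly n p).roots = (Finset.range n).val.map fun j => -(p ^ j)⁻¹ := by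
    rw [hfac, roots_C_mul _ hc]
    have := roots_multiset_prod_X_sub_C ((Finset.range n).val.map fun j => -(p ^ j)⁻¹)
    rwa [Multiset.map_map] at this
  have hdeg : (Rpoly n p).natDegree = n := by
    rw [hfac, natDegree_C_mul hc, natDegree_prod_of_monic _ _ fun j _ => monic_X_sub_C _]
    simp
  have hinj : Function.Injective fun j : ℕ => -(p ^ j)⁻¹ := by
    intro i j h
    simp only [neg_inj, inv_inj] at h
    exact pow_right_injective₀ hp (by linarith) h
  refine ⟨hdeg.le, Or.inr (by rw [hroots, hdeg]; simp), ?_⟩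
  rw [hroots]
  constructor
  · intro x _ _ h2
    have := Multiset.nodup_iff_count_le_one.1 ((Finset.range n).nodup.map hinj) x
    omega
  · intro x hx y hy hxy
    obtain ⟨i, -, rfl⟩ := Multiset.mem_map.1 hx
    obtain ⟨j, -, rfl⟩ := Multiset.mem_map.1 hy
    have hi := pow_pos hp i
    have hj := pow_pos hp j
    rcases hxy with ⟨h1, -⟩ | ⟨h1, -⟩
    · rw [neg_lt_neg_iff, inv_lt_inv₀ hi hj] at h1
      have hij : i < j := by
        by_contra hc'
        exact absurd (pow_le_pow_of_le_one hp.le (by linarith) (not_lt.1 hc')) (not_le.2 h1)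
      rw [neg_div_neg_eq, inv_div_inv]
      rw [div_lt_iff₀ hi]
      calc p ^ j ≤ p ^ (i + 1) := pow_le_pow_of_le_one hp.le (by linarith) hij
        _ = p * p ^ i := pow_succ' p i
        _ < q * p ^ i := mul_lt_mul_of_pos_right hpq hi
    · have := inv_pos.2 hi; linarith

lemma memRbar_of_preserves (hq : 0 < q) (hq1 : q ≤ 1) (hFn : F.natDegree ≤ n) (hF : F ≠ 0)
    (h : ∀ G, memR n q G → memR n q (qHadamard n q F G)) : memRbar n q F := by
  obtain ⟨p, -, hp, hlim⟩ := exists_seq_strictMono_tendsto' hq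
  have hcoeff : ∀ i k, (qHadamard n q F (Rpoly n (p i))).coeff k
      = F.coeff k * qBinom n k (p i) / qBinom n k q := fun i k => coeff_qHadamard _ _ _ _ _
  have htop : ∀ i, (qHadamard n q F (Rpoly n (p i))).coeff F.natDegree ≠ 0 := by
    intro i
    rw [hcoeff]
    exact div_ne_zero (mul_ne_zero (leadingCoeff_ne_zero.2 hF) (qBinom_pos (hp i).1 hFn).ne')
      (qBinom_pos hq hFn).ne'
  refine memRbar_of_tendsto hq1 hFn hF (P := fun i => qHadamard n q F (Rpoly n (p i))) ?_
    (fun i => h _ (memR_Rpoly (hp i).1 (hp i).2 hq1)) ?_ ?_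
  · intro i h0
    exact htop i (by rw [show qHadamard n q F (Rpoly n (p i)) = 0 from h0, coeff_zero])
  · intro i
    refine le_antisymm ((natDegree_le_iff_coeff_eq_zero).2 fun k hk => ?_)
      (le_natDegree_of_ne_zero (htop i))
    rw [hcoeff, coeff_eq_zero_of_natDegree_lt hk]; simp
  · intro k
    simp only [hcoeff]
    rcases le_or_gt k n with hk | hk
    · have h1 := (((continuous_qBinom n k).tendsto q).comp hlim).const_mul (F.coeff k)
      have h2 := h1.div_const (qBinom n k q)
      rwa [mul_div_cancel_right₀ _ (qBinom_pos hq hk).ne'] at h2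
    · rw [coeff_eq_zero_of_natDegree_lt (hFn.trans_lt hk)]; simp

end

/-- `F *_q^n G ∈ 𝓡_n(q)` for every `G ∈ 𝓡_n(q)` iff
`F(z) ∈ 𝓝̄_n(q)` or `F(-z) ∈ 𝓝̄_n(q)`. -/
theorem stmt0 (n : ℕ) (hn : 1 ≤ n) (q : ℝ) (hq0 : 0 < q) (hq1 : q ≤ 1)
    (F : Polynomial ℝ) (hF : F.natDegree ≤ n) :
    (∀ G : Polynomial ℝ, memR n q G → memR n q (qHadamard n q F G)) ↔
      (memNbar n q F ∨ memNbar n q (F.comp (-Polynomial.X))) := by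
  constructor
  · intro h
    rcases eq_or_ne F 0 with rfl | hF0
    · left
      exact ⟨⟨by simp, Or.inl rfl, by simp [LogSep]⟩, by simp [OnlyNonposRoots]⟩
    have hR := memRbar_of_preserves hq0 hq1 hF hF0 h
    refine (onlyNonposRoots_or rfl hF0 (hR.2.1.resolve_left hF0) fun i => ?_).imp
      (fun h' => ⟨hR, h'⟩) fun h' => ⟨memRbar_comp_neg hR, h'⟩
    rcases le_or_gt (i + 2) n with hi | hi
    · exact coeff_mul_coeff_nonneg hq0 h hi
    · rw [coeff_eq_zero_of_natDegree_lt (hF.trans_lt hi), mul_zero]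
  · rintro (h | h) G hG
    · exact memR_qHadamard_of_memNbar hq0 hq1 h hG
    · have := memR_comp_neg (memR_qHadamard_of_memNbar hq0 hq1 h hG)
      rwa [qHadamard_comm, qHadamard_comp_neg_right, comp_neg_X_comp_neg_X,
        qHadamard_comm] at this
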